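/- arXiv:1708.01814 — 3 statements merged into one kernel-verified Lean document; each statement's English description precedes it below -/
import Mathlib

section
/- Every 5-line subconfiguration of a real Schläfli six is deformation equivalent to a join configuration: if {L₁,…,L₆} is a real Schläfli six, then for each i there exists a permutation σ of {1,…,5} such that the configuration {L₁,…,L₆}∖{Lᵢ} is deformation equivalent to J(σ). -/
open Submodule

abbrev V4 : Type := Fin 4 → ℝ

abbrev PLine : Type := Submodule ℝ V4

def IsLine (P : PLine) : Prop := Module.finrank ℝ P = 2

def Skew (P Q : PLine) : Prop := IsLine P ∧ IsLine Q ∧ P ⊓ Q = ⊥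

def PairwiseSkew {n : ℕ} (L : Fin n → PLine) : Prop :=
  ∀ i j : Fin n, i ≠ j → Skew (L i) (L j)

noncomputable def det2 (a b c d : V4) : ℝ := Matrix.det (Matrix.of ![a, b, c, d])

open Classical in
noncomputable def lk (P Q R : PLine) : ℝ :=
  if h : ∃ v : Fin 6 → V4,
      P = span ℝ {v 0, v 1} ∧ Q = span ℝ {v 2, v 3} ∧ R = span ℝ {v 4, v 5} then
    Real.sign (det2 (h.choose 0) (h.choose 1) (h.choose 2) (h.choose 3) *
      det2 (h.choose 0) (h.choose 1) (h.choose 4) (h.choose 5) *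
      det2 (h.choose 2) (h.choose 3) (h.choose 4) (h.choose 5))
  else 0

noncomputable def sgnOf {n : ℕ} (L : Fin n → PLine) : ℝ :=
  ∑ i : Fin n, ∑ j : Fin n, ∑ k : Fin n,
    if i < j ∧ j < k then lk (L i) (L j) (L k) else 0

def ContinuousLineFamily (L : ℝ → PLine) : Prop :=
  ∃ v w : ℝ → V4, ContinuousOn v (Set.Icc 0 1) ∧ ContinuousOn w (Set.Icc 0 1) ∧
    ∀ t ∈ Set.Icc (0:ℝ) 1, L t = span ℝ {v t, w t}

def Deformation {n : ℕ} (L L' : Fin n → PLine) : Prop :=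
  ∃ F : ℝ → Fin n → PLine,
    (∀ i, ContinuousLineFamily (fun t => F t i)) ∧
    (∀ t ∈ Set.Icc (0:ℝ) 1, PairwiseSkew (F t)) ∧
    F 0 = L ∧ F 1 = L'

def DeformEquiv {n : ℕ} (L L' : Fin n → PLine) : Prop :=
  ∃ π π' : Equiv.Perm (Fin n), Deformation (L ∘ π) (L' ∘ π')

def IsMirror {n : ℕ} (L L' : Fin n → PLine) : Prop :=
  ∃ A : V4 →ₗ[ℝ] V4, LinearMap.det A < 0 ∧ ∀ i, L' i = (L i).map A

def CoarseDeformEquiv {n : ℕ} (L L' : Fin n → PLine) : Prop :=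
  DeformEquiv L L' ∨ ∃ M : Fin n → PLine, IsMirror L' M ∧ DeformEquiv L M

noncomputable def joinConfig {n : ℕ} (σ : Equiv.Perm (Fin n)) : Fin n → PLine :=
  fun i => span ℝ {![1, (i.val : ℝ) + 1, 0, 0], ![0, 0, ((σ i).val : ℝ) + 1, 1]}

def IsSchlafliSix (L : Fin 6 → PLine) : Prop :=
  PairwiseSkew L ∧
  ∃ F : MvPolynomial (Fin 4) ℝ,
    F ≠ 0 ∧ F.IsHomogeneous 3 ∧
    (∀ i : Fin 6, ∀ x ∈ L i, MvPolynomial.eval x F = 0) ∧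
    (∀ z : Fin 4 → ℂ, z ≠ 0 →
      MvPolynomial.eval z (MvPolynomial.map (algebraMap ℝ ℂ) F) = 0 →
      ∃ j : Fin 4, MvPolynomial.eval z (MvPolynomial.map (algebraMap ℝ ℂ) (MvPolynomial.pderiv j F)) ≠ 0)

def Reducible {n : ℕ} (L : Fin n → PLine) : Prop :=
  ∃ i j : Fin n, i ≠ j ∧ ∃ F : ℝ → Fin n → PLine,
    (∀ k, ContinuousLineFamily (fun t => F t k)) ∧
    F 0 = L ∧
    (∀ t ∈ Set.Ico (0:ℝ) 1, PairwiseSkew (F t)) ∧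
    F 1 i = F 1 j ∧
    (∀ k l : Fin n, k ≠ l → ¬(k = i ∧ l = j) → ¬(k = j ∧ l = i) → Skew (F 1 k) (F 1 l))


theorem exists_add_mul_ne_zero {ι : Type*} [Finite ι] (P Q : ι → ℝ)
    (h : ∀ k, P k ≠ 0 ∨ Q k ≠ 0) : ∃ c : ℝ, ∀ k, P k + c * Q k ≠ 0 := by
  obtain ⟨c, hc⟩ := (Set.finite_range fun k => -P k / Q k).infinite_compl.nonempty
  refine ⟨c, fun k hk => ?_⟩
  by_cases hQ : Q k = 0
  · exact (h k).elim (fun hP => hP (by simpa [hQ] using hk)) (fun hQ' => hQ' hQ)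
  · exact hc ⟨k, by field_simp; linarith⟩

theorem det2_eq (a b c d : V4) : det2 a b c d =
    (a 0 * b 1 - a 1 * b 0) * (c 2 * d 3 - c 3 * d 2)
    - (a 0 * b 2 - a 2 * b 0) * (c 1 * d 3 - c 3 * d 1)
    + (a 0 * b 3 - a 3 * b 0) * (c 1 * d 2 - c 2 * d 1)
    + (a 1 * b 2 - a 2 * b 1) * (c 0 * d 3 - c 3 * d 0)
    - (a 1 * b 3 - a 3 * b 1) * (c 0 * d 2 - c 2 * d 0)
    + (a 2 * b 3 - a 3 * b 2) * (c 0 * d 1 - c 1 * d 0) := by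
  simp [det2, Matrix.det_succ_row_zero, Fin.sum_univ_succ, Fin.succAbove]
  ring

theorem det2_mulVec (B : Matrix (Fin 4) (Fin 4) ℝ) (a b c d : V4) :
    det2 (B.mulVec a) (B.mulVec b) (B.mulVec c) (B.mulVec d) = B.det * det2 a b c d := by
  have h : Matrix.of ![B.mulVec a, B.mulVec b, B.mulVec c, B.mulVec d] =
      Matrix.of ![a, b, c, d] * B.transpose := by
    ext i j
    fin_cases i <;> simp [Matrix.mul_apply, Matrix.mulVec, dotProduct, mul_comm]
  rw [det2, h, Matrix.det_mul, Matrix.det_transpose, mul_comm, det2]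

theorem det2_ne_zero_iff (a b c d : V4) :
    det2 a b c d ≠ 0 ↔ LinearIndependent ℝ ![a, b, c, d] := by
  rw [det2, ← isUnit_iff_ne_zero, ← Matrix.isUnit_iff_isUnit_det,
    ← Matrix.linearIndependent_rows_iff_isUnit]
  rfl

theorem det2_ne_zero_iff_forall (a b c d : V4) : det2 a b c d ≠ 0 ↔
    ∀ x y z w : ℝ, x • a + y • b = z • c + w • d → x = 0 ∧ y = 0 ∧ z = 0 ∧ w = 0 := by
  rw [det2_ne_zero_iff, Fintype.linearIndependent_iff]
  constructor
  · intro h x y z w hxy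
    have := h ![x, y, -z, -w] (by
      simp only [Fin.sum_univ_four, Matrix.cons_val]
      rw [add_assoc, hxy]; module)
    exact ⟨this 0, this 1, neg_eq_zero.1 (this 2), neg_eq_zero.1 (this 3)⟩
  · intro h g hg i
    simp only [Fin.sum_univ_four, Matrix.cons_val] at hg
    obtain ⟨h0, h1, h2, h3⟩ := h (g 0) (g 1) (-g 2) (-g 3) (by
      rw [add_assoc, add_eq_zero_iff_eq_neg] at hg; rw [hg]; module)
    fin_cases i
    exacts [h0, h1, neg_eq_zero.1 h2, neg_eq_zero.1 h3]

theorem isLine_span_pair {a b : V4} :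
    IsLine (span ℝ {a, b}) ↔ LinearIndependent ℝ ![a, b] := by
  rw [linearIndependent_iff_card_eq_finrank_span, IsLine, Set.finrank,
    Matrix.range_cons_cons_empty, Fintype.card_fin, eq_comm]

theorem skew_span_pair_iff (a b c d : V4) :
    Skew (span ℝ {a, b}) (span ℝ {c, d}) ↔ det2 a b c d ≠ 0 := by
  rw [det2_ne_zero_iff_forall, Skew, isLine_span_pair, isLine_span_pair,
    LinearIndependent.pair_iff, LinearIndependent.pair_iff, Submodule.eq_bot_iff]
  constructor
  · rintro ⟨hab, hcd, h⟩ x y z w hxy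
    have h0 := h (x • a + y • b)
      ⟨mem_span_pair.2 ⟨x, y, rfl⟩, mem_span_pair.2 ⟨z, w, hxy.symm⟩⟩
    obtain ⟨hx, hy⟩ := hab x y h0
    obtain ⟨hz, hw⟩ := hcd z w (hxy ▸ h0)
    exact ⟨hx, hy, hz, hw⟩
  · intro h
    refine ⟨fun x y hxy => ?_, fun z w hzw => ?_, ?_⟩
    · obtain ⟨hx, hy, -⟩ := h x y 0 0 (by simp [hxy])
      exact ⟨hx, hy⟩
    · obtain ⟨-, -, hz, hw⟩ := h 0 0 z w (by simp [hzw])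
      exact ⟨hz, hw⟩
    · rintro v ⟨hv, hv'⟩
      obtain ⟨x, y, rfl⟩ := mem_span_pair.1 hv
      obtain ⟨z, w, hzw⟩ := mem_span_pair.1 hv'
      obtain ⟨rfl, rfl, -⟩ := h x y z w hzw.symm
      simp

/-- The frames of configurations of `n` pairwise skew lines. -/
def skewFrames (n : ℕ) : Set (Fin n → V4 × V4) :=
  {f | ∀ i j, i ≠ j → det2 (f i).1 (f i).2 (f j).1 (f j).2 ≠ 0}

/-- The lines spanned by a frame. -/
def frameLines {n : ℕ} (f : Fin n → V4 × V4) : Fin n → PLine :=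
  fun i => span ℝ {(f i).1, (f i).2}

theorem pairwiseSkew_frameLines_iff {n : ℕ} (f : Fin n → V4 × V4) :
    PairwiseSkew (frameLines f) ↔ f ∈ skewFrames n :=
  forall₃_congr fun _ _ _ => skew_span_pair_iff _ _ _ _

theorem deformation_of_joinedIn {n : ℕ} {f g : Fin n → V4 × V4}
    (h : JoinedIn (skewFrames n) f g) : Deformation (frameLines f) (frameLines g) := by
  obtain ⟨γ, hγ⟩ := h
  refine ⟨fun t => frameLines (γ.extend t), fun i => ?_, fun t ht => ?_, ?_, ?_⟩
  · exact ⟨fun t => (γ.extend t i).1, fun t => (γ.extend t i).2,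
      by fun_prop, by fun_prop, fun t _ => rfl⟩
  · rw [pairwiseSkew_frameLines_iff, γ.extend_apply ht]
    exact hγ _
  · simp
  · simp

/-- Planar vectors, pairwise not proportional. -/
def nonParallel (n : ℕ) : Set (Fin n → ℝ × ℝ) :=
  {P | ∀ i j, i ≠ j → (P i).1 * (P j).2 - (P i).2 * (P j).1 ≠ 0}

theorem exists_perm_lt {n : ℕ} (X : Fin n → ℝ) :
    ∃ ρ : Equiv.Perm (Fin n), ∀ i j, X i < X j → ρ i < ρ j := by
  refine ⟨(Tuple.sort X)⁻¹, fun i j hij => ?_⟩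
  by_contra! hle
  have := Tuple.monotone_sort X hle
  simp at this
  linarith

theorem exists_joinedIn_nonParallel {n : ℕ} (hn : 2 ≤ n) {P : Fin n → ℝ × ℝ}
    (hP : P ∈ nonParallel n) :
    ∃ (c : Fin n → ℝ) (ρ : Equiv.Perm (Fin n)), (∀ i, c i ≠ 0) ∧
      JoinedIn (nonParallel n) P fun i => (c i, c i * ((ρ i : ℕ) + 1 : ℝ)) := by
  obtain ⟨s, hs⟩ := exists_add_mul_ne_zero (fun i => (P i).1) (fun i => (P i).2) fun i => by
    have : Nontrivial (Fin n) := Fin.nontrivial_iff_two_le.2 hn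
    obtain ⟨j, hj⟩ := exists_ne i
    by_contra! h
    exact hP j i hj (by rw [h.1, h.2]; ring)
  set c : Fin n → ℝ := fun i => (P i).1 + s * (P i).2
  set X : Fin n → ℝ := fun i => (P i).2 / c i
  have hX : Function.Injective X := by
    intro i j hij
    by_contra hne
    apply hP i j hne
    have hi := hs i
    have hj := hs j
    simp only [X, c] at hij
    rw [div_eq_div_iff hi hj] at hij
    linear_combination -hij
  obtain ⟨ρ, hρ⟩ := exists_perm_lt X
  refine ⟨c, ρ, hs, .trans (y := fun i => (c i, (P i).2)) ?_ ?_⟩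
  · refine .ofLine (f := fun t i => ((P i).1 + t * s * (P i).2, (P i).2)) (by fun_prop)
      (by simp) (by simp [c]) ?_
    rintro _ ⟨t, -, rfl⟩ i j hij h
    exact hP i j hij (by linear_combination h)
  · refine .ofLine (f := fun t i =>
      (c i, c i * ((1 - t) * X i + t * ((ρ i : ℕ) + 1 : ℝ)))) (by fun_prop) ?_ (by simp) ?_
    · ext i
      · rfl
      · simp only [X]
        field_simp [show c i ≠ 0 from hs i]
        ring
    · have key : ∀ t ∈ Set.Icc (0 : ℝ) 1, ∀ i j, X i < X j →
          (1 - t) * X i + t * ((ρ i : ℕ) + 1 : ℝ) < (1 - t) * X j + t * ((ρ j : ℕ) + 1 : ℝ) := by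
        intro t ht i j hij
        have h1 : ((ρ i : ℕ) : ℝ) < (ρ j : ℕ) := by exact_mod_cast hρ i j hij
        rcases ht.2.eq_or_lt with rfl | h
        · linarith
        · have := mul_lt_mul_of_pos_left hij (sub_pos.2 h)
          have := mul_le_mul_of_nonneg_left h1.le ht.1
          linarith
      rintro _ ⟨t, ht, rfl⟩ i j hij
      have hne : (1 - t) * X i + t * ((ρ i : ℕ) + 1 : ℝ) ≠
          (1 - t) * X j + t * ((ρ j : ℕ) + 1 : ℝ) := by
        rcases lt_or_gt_of_ne (hX.ne hij) with h | h
        · exact (key t ht i j h).ne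
        · exact (key t ht j i h).ne'
      have := mul_ne_zero (mul_ne_zero (hs i) (hs j)) (sub_ne_zero.2 hne.symm)
      convert this using 1
      ring

open Matrix in
theorem joinedIn_det_ne_zero_transvections {n : Type*} [Fintype n] [DecidableEq n]
    (L : List (TransvectionStruct n ℝ)) :
    JoinedIn {A : Matrix n n ℝ | A.det ≠ 0} (L.map TransvectionStruct.toMatrix).prod 1 := by
  induction L with
  | nil => exact .refl (by simp)
  | cons s L ih =>
    have hs : JoinedIn {A : Matrix n n ℝ | A.det ≠ 0} s.toMatrix 1 := by
      refine .ofLine (f := fun t => transvection s.i s.j ((1 - t) * s.c)) ?_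
        (by simp [TransvectionStruct.toMatrix]) (by simp) ?_
      · have : Continuous fun c : ℝ => (Matrix.single s.i s.j c : Matrix n n ℝ) :=
          continuous_matrix fun i j => by
            simp only [Matrix.single_apply]
            split_ifs <;> fun_prop
        exact (continuous_const.add (this.comp (by fun_prop))).continuousOn
      · rintro _ ⟨t, -, rfl⟩
        simp [det_transvection_of_ne _ _ s.hij]
    simpa using (hs.mul ih).mono (by
      rintro _ ⟨A, hA, A', hA', rfl⟩
      simpa using ⟨hA, hA'⟩)

open Matrix in
theorem exists_joinedIn_diagonal {n : Type*} [Fintype n] [DecidableEq n]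
    {A : Matrix n n ℝ} (hA : A.det ≠ 0) :
    ∃ D : n → ℝ, JoinedIn {A : Matrix n n ℝ | A.det ≠ 0} A (diagonal D) := by
  obtain ⟨L, L', D, rfl⟩ := Pivot.exists_list_transvec_mul_diagonal_mul_list_transvec A
  have hD : (diagonal D).det ≠ 0 := by simp_all
  refine ⟨D, ?_⟩
  have := ((joinedIn_det_ne_zero_transvections L).mul
    (.refl (Set.mem_singleton (diagonal D)))).mul (joinedIn_det_ne_zero_transvections L')
  simpa using this.mono (by
    rintro _ ⟨_, ⟨A, hA, _, rfl, rfl⟩, A', hA', rfl⟩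
    simpa [mul_ne_zero_iff] using ⟨⟨hA, by simpa using hD⟩, hA'⟩)

/-- The image of a frame under a linear map. -/
def mapFrame {n : ℕ} (B : Matrix (Fin 4) (Fin 4) ℝ) (f : Fin n → V4 × V4) : Fin n → V4 × V4 :=
  fun i => (B.mulVec (f i).1, B.mulVec (f i).2)

theorem mapFrame_mem_skewFrames_iff {n : ℕ} {B : Matrix (Fin 4) (Fin 4) ℝ} (hB : B.det ≠ 0)
    {f : Fin n → V4 × V4} : mapFrame B f ∈ skewFrames n ↔ f ∈ skewFrames n := by
  simp [skewFrames, mapFrame, det2_mulVec, hB]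

theorem exists_joinedIn_join {n : ℕ} (hn : 2 ≤ n) {f : Fin n → V4 × V4} (hf : f ∈ skewFrames n)
    (h2 : ∀ i, (f i).1 2 = 0) (h3 : ∀ i, (f i).1 3 = 0) :
    ∃ (c d : Fin n → ℝ) (ρ τ : Equiv.Perm (Fin n)), (∀ i, c i ≠ 0) ∧ (∀ i, d i ≠ 0) ∧
      JoinedIn (skewFrames n) f fun i =>
        (![c i, c i * ((ρ i : ℕ) + 1 : ℝ), 0, 0], ![0, 0, d i * ((τ i : ℕ) + 1 : ℝ), d i]) := by
  have hdet : ∀ i j, det2 (f i).1 (f i).2 (f j).1 (f j).2 =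
      -(((f i).1 0 * (f j).1 1 - (f i).1 1 * (f j).1 0) *
        ((f i).2 2 * (f j).2 3 - (f i).2 3 * (f j).2 2)) := fun i j => by
    rw [det2_eq, h2, h3, h2, h3]; ring
  have hP : (fun i => ((f i).1 0, (f i).1 1)) ∈ nonParallel n := fun i j hij h =>
    hf i j hij (by rw [hdet]; simp only at h; rw [h]; ring)
  have hQ : (fun i => ((f i).2 3, (f i).2 2)) ∈ nonParallel n := fun i j hij h =>
    hf i j hij (by
      rw [hdet]
      simp only at h
      linear_combination ((f i).1 0 * (f j).1 1 - (f i).1 1 * (f j).1 0) * h)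
  obtain ⟨c, ρ, hc, hρ⟩ := exists_joinedIn_nonParallel hn hP
  obtain ⟨d, τ, hd, hτ⟩ := exists_joinedIn_nonParallel hn hQ
  refine ⟨c, d, ρ, τ, hc, hd, .trans
    (y := fun i => (![(f i).1 0, (f i).1 1, 0, 0], ![0, 0, (f i).2 2, (f i).2 3])) ?_ ?_⟩
  · refine .ofLine (f := fun t i => ((f i).1,
      ![(1 - t) * (f i).2 0, (1 - t) * (f i).2 1, (f i).2 2, (f i).2 3])) ?_ ?_ ?_ ?_
    · fun_prop
    · ext i j
      · rfl
      · fin_cases j <;> simp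
    · ext i j
      · fin_cases j <;> simp [h2, h3]
      · fin_cases j <;> simp
    · rintro _ ⟨t, -, rfl⟩ i j hij h
      apply hf i j hij
      rw [hdet]
      simp [det2_eq, h2, h3] at h ⊢
      grind
  · have := (hρ.prod hτ).map
      (f := fun p : (Fin n → ℝ × ℝ) × (Fin n → ℝ × ℝ) => fun i =>
        ((![(p.1 i).1, (p.1 i).2, 0, 0], ![0, 0, (p.2 i).2, (p.2 i).1]) : V4 × V4)) (by fun_prop)
    refine this.mono ?_
    rintro _ ⟨⟨P, Q⟩, ⟨hP, hQ⟩, rfl⟩ i j hij h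
    refine mul_ne_zero (hP i j hij) (hQ i j hij) ?_
    simp [det2_eq] at h ⊢
    grind

theorem exists_mulVec_eq {n : ℕ} {B : Matrix (Fin n) (Fin n) ℝ} (hB : B.det ≠ 0)
    (v : Fin n → ℝ) : ∃ w, B.mulVec w = v :=
  ⟨B⁻¹.mulVec v, by simp [Matrix.mulVec_mulVec, Matrix.mul_nonsing_inv _ (isUnit_iff_ne_zero.2 hB)]⟩

/-- The matrix with the given columns. -/
def ofColumns (a b c d : V4) : Matrix (Fin 4) (Fin 4) ℝ := (Matrix.of ![a, b, c, d]).transpose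

theorem det_ofColumns (a b c d : V4) : (ofColumns a b c d).det = det2 a b c d :=
  Matrix.det_transpose _

theorem ofColumns_mulVec (a b c d : V4) (v : V4) :
    (ofColumns a b c d).mulVec v = v 0 • a + v 1 • b + v 2 • c + v 3 • d := by
  ext i
  simp [ofColumns, Matrix.mulVec, dotProduct, Fin.sum_univ_four, mul_comm]

theorem span_pair_smul {a b : V4} {c d : ℝ} (hc : c ≠ 0) (hd : d ≠ 0) :
    span ℝ {c • a, d • b} = span ℝ {a, b} := by
  rw [span_insert, span_insert, span_singleton_smul_eq hc.isUnit, span_singleton_smul_eq hd.isUnit]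

theorem exists_deformEquiv_joinConfig_of_transversal {n : ℕ} {f g : Fin (n + 2) → V4 × V4}
    (hfg : JoinedIn (skewFrames (n + 2)) f g)
    (hp : ∀ i, ∃ x y : ℝ, (g i).1 = x • (g 0).1 + y • (g 1).1) :
    ∃ σ, DeformEquiv (frameLines f) (joinConfig σ) := by
  have hB : (ofColumns (g 0).1 (g 1).1 (g 0).2 (g 1).2).det ≠ 0 := by
    have := hfg.target_mem 0 1 (by simp)
    rw [det_ofColumns]
    rw [det2_eq] at this ⊢
    grind
  set B := ofColumns (g 0).1 (g 1).1 (g 0).2 (g 1).2 with hBdef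
  choose x y hxy using hp
  choose r hr using fun i => exists_mulVec_eq hB (g i).2
  set h : Fin (n + 2) → V4 × V4 := fun i => (![x i, y i, 0, 0], r i)
  have hBh : mapFrame B h = g := by
    ext1 i
    refine Prod.ext ?_ (hr i)
    simp [mapFrame, h, hBdef, ofColumns_mulVec, hxy i]
  have hh : h ∈ skewFrames (n + 2) := by
    rw [← mapFrame_mem_skewFrames_iff hB, hBh]
    exact hfg.target_mem
  obtain ⟨D, hD⟩ := exists_joinedIn_diagonal hB
  have hgD : JoinedIn (skewFrames (n + 2)) g (mapFrame (Matrix.diagonal D) h) := by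
    rw [← hBh]
    refine (hD.map (f := fun A => mapFrame A h) ?_).mono ?_
    · unfold mapFrame
      fun_prop
    · rintro _ ⟨A, hA, rfl⟩
      exact (mapFrame_mem_skewFrames_iff hA).2 hh
  obtain ⟨c, d, ρ, τ, hc, hd, hj⟩ := exists_joinedIn_join (by lia) hgD.target_mem
    (by simp [mapFrame, h, Matrix.mulVec_diagonal]) (by simp [mapFrame, h, Matrix.mulVec_diagonal])
  refine ⟨τ * ρ⁻¹, 1, ρ, Eq.subst (motive := Deformation (frameLines f)) ?_
    (deformation_of_joinedIn (hfg.trans (hgD.trans hj)))⟩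
  ext1 i
  simp only [frameLines, joinConfig, Function.comp_apply]
  simpa using span_pair_smul (a := ![1, ((ρ i : ℕ) : ℝ) + 1, 0, 0])
    (b := ![0, 0, ((τ i : ℕ) : ℝ) + 1, 1]) (hc i) (hd i)

/-- Frames of the lines `{(u, 0)}`, `{(0, u)}`, `{(u, u)}`, `{(u, M u)}`, `{(u, N u)}` in `ℝ² × ℝ²`. -/
def graphFrames (M N : Matrix (Fin 2) (Fin 2) ℝ) : Fin 5 → V4 × V4 :=
  ![(![1, 0, 0, 0], ![0, 1, 0, 0]), (![0, 0, 1, 0], ![0, 0, 0, 1]), (![1, 0, 1, 0], ![0, 1, 0, 1]),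
    (![1, 0, M 0 0, M 1 0], ![0, 1, M 0 1, M 1 1]), (![1, 0, N 0 0, N 1 0], ![0, 1, N 0 1, N 1 1])]

theorem graphFrames_mem_skewFrames_iff (M N : Matrix (Fin 2) (Fin 2) ℝ) :
    graphFrames M N ∈ skewFrames 5 ↔
      M.det ≠ 0 ∧ (M - 1).det ≠ 0 ∧ N.det ≠ 0 ∧ (N - 1).det ≠ 0 ∧ (M - N).det ≠ 0 := by
  constructor
  · intro h
    have h03 := h 0 3 (by simp)
    have h23 := h 2 3 (by simp)
    have h04 := h 0 4 (by simp)
    have h24 := h 2 4 (by simp)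
    have h34 := h 3 4 (by simp)
    simp [graphFrames, det2_eq] at h03 h23 h04 h24 h34
    simp [Matrix.det_fin_two]
    grind
  · rintro ⟨h03, h23, h04, h24, h34⟩ i j hij
    simp [Matrix.det_fin_two] at h03 h23 h04 h24 h34
    fin_cases i <;> fin_cases j <;> first | exact absurd rfl hij | skip
    all_goals
      clear hij
      simp [graphFrames, det2_eq]
      try grind

theorem exists_joinedIn_graphFrames_smul_one {X : Matrix (Fin 2) (Fin 2) ℝ}
    (hX : ∀ p q : ℝ, p ≠ 0 ∨ q ≠ 0 → (p • 1 + q • X).det ≠ 0) {p q p' q' : ℝ}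
    (h : graphFrames (p • 1 + q • X) (p' • 1 + q' • X) ∈ skewFrames 5) :
    ∃ r r' : ℝ, JoinedIn (skewFrames 5) (graphFrames (p • 1 + q • X) (p' • 1 + q' • X))
      (graphFrames (r • 1) (r' • 1)) := by
  have hX' : ∀ p q : ℝ, (p • 1 + q • X).det ≠ 0 ↔ (p ≠ 0 ∨ q ≠ 0) := fun p q =>
    ⟨fun h => by
      by_contra! h0
      simp [h0] at h, hX p q⟩
  have hdiff : ∀ p q p' q' : ℝ, p • 1 + q • X - (p' • 1 + q' • X) =
      (p - p') • 1 + (q - q') • X := fun p q p' q' => by module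
  have hone : ∀ p q : ℝ, p • 1 + q • X - 1 = (p - 1) • 1 + q • X := fun p q => by module
  have hmem : ∀ p q p' q' : ℝ, graphFrames (p • 1 + q • X) (p' • 1 + q' • X) ∈ skewFrames 5 ↔
      ∀ k : Fin 5, ![p, p - 1, p', p' - 1, p - p'] k ≠ 0 ∨ ![q, q, q', q', q - q'] k ≠ 0 := by
    intro p q p' q'
    simp only [graphFrames_mem_skewFrames_iff, hdiff, hone, hX', Fin.forall_fin_succ]
    simp
  rw [hmem] at h
  obtain ⟨c, hc⟩ := exists_add_mul_ne_zero _ _ h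
  refine ⟨p + c * q, p' + c * q', .ofLine (f := fun t => graphFrames
    ((p + t * c * q) • 1 + ((1 - t) * q) • X) ((p' + t * c * q') • 1 + ((1 - t) * q') • X))
    ?_ (by simp) (by simp) ?_⟩
  · refine continuousOn_pi.2 fun i => ?_
    fin_cases i <;> simp [graphFrames] <;> fun_prop
  · rintro _ ⟨t, -, rfl⟩
    rw [hmem]
    intro k
    have key : ∀ P Q : ℝ, P ≠ 0 ∨ Q ≠ 0 → P + c * Q ≠ 0 →
        P + t * c * Q ≠ 0 ∨ (1 - t) * Q ≠ 0 := by
      intro P Q h h'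
      by_contra! h0
      rcases mul_eq_zero.1 h0.2 with ht | hQ
      · obtain rfl : t = 1 := by linarith
        exact h' (by linarith [h0.1])
      · simp_all
    have := key _ _ (h k) (hc k)
    fin_cases k <;> simp at this ⊢ <;> grind

theorem exists_deformEquiv_of_pencil {B : Matrix (Fin 4) (Fin 4) ℝ} (hB : B.det ≠ 0)
    {X : Matrix (Fin 2) (Fin 2) ℝ}
    (hX : ∀ p q : ℝ, p ≠ 0 ∨ q ≠ 0 → (p • 1 + q • X).det ≠ 0) {p q p' q' : ℝ}
    (h : graphFrames (p • 1 + q • X) (p' • 1 + q' • X) ∈ skewFrames 5) :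
    ∃ σ, DeformEquiv (frameLines (mapFrame B (graphFrames (p • 1 + q • X) (p' • 1 + q' • X))))
      (joinConfig σ) := by
  obtain ⟨r, r', hr⟩ := exists_joinedIn_graphFrames_smul_one hX h
  refine exists_deformEquiv_joinConfig_of_transversal (g := mapFrame B (graphFrames (r • 1) (r' • 1)))
    ((hr.map (f := mapFrame B) ?_).mono ?_) fun i => ?_
  · unfold mapFrame
    fun_prop
  · rintro _ ⟨f, hf, rfl⟩
    exact (mapFrame_mem_skewFrames_iff hB).2 hf
  · refine ⟨![1, 0, 1, 1, 1] i, ![0, 1, 1, r, r'] i, ?_⟩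
    simp only [mapFrame, ← Matrix.mulVec_smul, ← Matrix.mulVec_add]
    congr 1
    fin_cases i <;> simp [graphFrames]

theorem exists_span_pair_eq {V : Type*} [AddCommGroup V] [Module ℝ V] {K : Submodule ℝ V}
    (hK : Module.finrank ℝ K = 2) {p : V} (hp : p ∈ K) (hp0 : p ≠ 0) :
    ∃ r, K = span ℝ {p, r} := by
  have : FiniteDimensional ℝ K := .of_finrank_pos (by lia)
  obtain ⟨r, hr, hrp⟩ : ∃ r ∈ K, r ∉ span ℝ {p} := by
    by_contra! h
    have h1 := Submodule.finrank_mono (show K ≤ span ℝ {p} from h)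
    have h2 := finrank_span_singleton (K := ℝ) hp0
    lia
  refine ⟨r, (Submodule.eq_of_le_of_finrank_eq (span_le.2 (by simp [Set.insert_subset_iff, hp, hr])) ?_).symm⟩
  have hli : LinearIndependent ℝ ![p, r] := by
    rw [LinearIndependent.pair_iff' hp0]
    rintro a rfl
    exact hrp (mem_span_singleton.2 ⟨a, rfl⟩)
  have := finrank_span_eq_card hli
  rw [Matrix.range_cons_cons_empty] at this
  rw [this, hK, Fintype.card_fin]

theorem exists_deformEquiv_of_eigenvector {B : Matrix (Fin 4) (Fin 4) ℝ} (hB : B.det ≠ 0)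
    {M N : Matrix (Fin 2) (Fin 2) ℝ} (h : graphFrames M N ∈ skewFrames 5)
    {u : Fin 2 → ℝ} (hu : u ≠ 0) {r r' : ℝ} (hM : M.mulVec u = r • u) (hN : N.mulVec u = r' • u) :
    ∃ σ, DeformEquiv (frameLines (mapFrame B (graphFrames M N))) (joinConfig σ) := by
  have hBh := (mapFrame_mem_skewFrames_iff hB).2 h
  have hskew := (pairwiseSkew_frameLines_iff _).2 hBh
  have hinj : ∀ v, B.mulVec v = 0 → v = 0 := fun v hv => Matrix.eq_zero_of_mulVec_eq_zero hB hv
  set v : Fin 5 → V4 := fun i => ![![1, 0, 1, 1, 1] i * u 0, ![1, 0, 1, 1, 1] i * u 1,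
    ![0, 1, 1, r, r'] i * u 0, ![0, 1, 1, r, r'] i * u 1] with hv
  have hmem : ∀ i, B.mulVec (v i) ∈ frameLines (mapFrame B (graphFrames M N)) i := by
    intro i
    refine mem_span_pair.2 ⟨u 0, u 1, ?_⟩
    have hM0 := congrFun hM 0
    have hM1 := congrFun hM 1
    have hN0 := congrFun hN 0
    have hN1 := congrFun hN 1
    simp [Matrix.mulVec, dotProduct] at hM0 hM1 hN0 hN1
    simp only [mapFrame, ← Matrix.mulVec_smul, ← Matrix.mulVec_add]
    congr 1
    ext j
    fin_cases i <;> fin_cases j <;> simp [graphFrames, hv] <;> linarith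
  have hne : ∀ i, B.mulVec (v i) ≠ 0 := by
    intro i hi
    apply hu
    have := hinj _ hi
    have h0 := congrFun this 0
    have h1 := congrFun this 1
    have h2 := congrFun this 2
    have h3 := congrFun this 3
    clear hi this
    ext j
    fin_cases i <;> fin_cases j <;> simp [hv] at h0 h1 h2 h3 ⊢ <;> assumption
  have hline : ∀ i, IsLine (frameLines (mapFrame B (graphFrames M N)) i) := fun i => by
    obtain ⟨j, hj⟩ := exists_ne i
    exact (hskew j i hj).2.1
  choose s hs using fun i => exists_span_pair_eq (hline i) (hmem i) (hne i)
  have heq : frameLines (mapFrame B (graphFrames M N)) = frameLines fun i => (B.mulVec (v i), s i) :=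
    funext hs
  rw [heq] at hskew ⊢
  refine exists_deformEquiv_joinConfig_of_transversal
    (.refl ((pairwiseSkew_frameLines_iff _).1 hskew)) fun i => ?_
  refine ⟨![1, 0, 1, 1, 1] i, ![0, 1, 1, r, r'] i, ?_⟩
  simp only [← Matrix.mulVec_smul, ← Matrix.mulVec_add]
  congr 1
  ext j
  fin_cases i <;> fin_cases j <;> simp [hv]

theorem IsLine.eq_span_pair {P : PLine} (hP : IsLine P) {a b : V4} (ha : a ∈ P) (hb : b ∈ P)
    (h : IsLine (span ℝ {a, b})) : P = span ℝ {a, b} := by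
  refine (Submodule.eq_of_le_of_finrank_eq (span_le.2 ?_) (h.trans hP.symm)).symm
  rintro x (rfl | rfl) <;> assumption

theorem Skew.eq_zero {P Q : PLine} (h : Skew P Q) {x : V4} (hP : x ∈ P) (hQ : x ∈ Q) : x = 0 := by
  have : x ∈ P ⊓ Q := ⟨hP, hQ⟩
  rwa [h.2.2] at this

theorem Skew.exists_add_mem {P Q : PLine} (h : Skew P Q) (a : V4) : ∃ b ∈ P, a + b ∈ Q := by
  have htop : P ⊔ Q = ⊤ := by
    refine Submodule.eq_top_of_finrank_eq ?_
    have := Submodule.finrank_sup_add_finrank_inf_eq P Q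
    rw [h.2.2, h.1, h.2.1, finrank_bot] at this
    simpa using this
  obtain ⟨p, hp, q, hq, hpq⟩ := Submodule.mem_sup.1 (htop ▸ Submodule.mem_top : a ∈ P ⊔ Q)
  exact ⟨-p, P.neg_mem hp, by simpa [← hpq] using hq⟩

theorem exists_eq_frameLines_mapFrame_graphFrames {K : Fin 5 → PLine} (hK : PairwiseSkew K) :
    ∃ (B : Matrix (Fin 4) (Fin 4) ℝ) (M N : Matrix (Fin 2) (Fin 2) ℝ),
      B.det ≠ 0 ∧ K = frameLines (mapFrame B (graphFrames M N)) := by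
  have hline : ∀ i, IsLine (K i) := fun i => by
    obtain ⟨j, hj⟩ := exists_ne i
    exact (hK j i hj).2.1
  obtain ⟨a₀, a₁, ha⟩ : ∃ a b : V4, K 0 = span ℝ {a, b} := by
    let e := Module.finBasisOfFinrankEq ℝ (K 0) (hline 0)
    refine ⟨e 0, e 1, ?_⟩
    have := congrArg (Submodule.map (K 0).subtype) e.span_eq
    rw [Submodule.map_span, Submodule.map_top, Submodule.range_subtype] at this
    refine this.symm.trans (congrArg _ ?_)
    ext x
    simp [eq_comm]
  have ha₀ : a₀ ∈ K 0 := ha ▸ subset_span (by simp)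
  have ha₁ : a₁ ∈ K 0 := ha ▸ subset_span (by simp)
  have hpair : ∀ {i : Fin 5} {b₀ b₁ : V4}, i ≠ 0 → i ≠ 1 → b₀ ∈ K 1 → b₁ ∈ K 1 →
      a₀ + b₀ ∈ K i → a₁ + b₁ ∈ K i → K i = span ℝ {a₀ + b₀, a₁ + b₁} := by
    intro i b₀ b₁ h0 h1 hb₀ hb₁ h₀ h₁
    refine (hline i).eq_span_pair h₀ h₁ ?_
    have hli := hline 0
    rw [ha, isLine_span_pair, LinearIndependent.pair_iff] at hli
    rw [isLine_span_pair, LinearIndependent.pair_iff]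
    intro x y hxy
    refine hli x y ((hK 0 1 (by simp)).eq_zero ?_ ?_)
    · exact add_mem ((K 0).smul_mem x ha₀) ((K 0).smul_mem y ha₁)
    · have : x • a₀ + y • a₁ = -(x • b₀ + y • b₁) := by
        rw [eq_neg_iff_add_eq_zero, ← hxy]; module
      rw [this]
      exact neg_mem (add_mem ((K 1).smul_mem x hb₀) ((K 1).smul_mem y hb₁))
  obtain ⟨b₀, hb₀, hab₀⟩ := (hK 1 2 (by simp)).exists_add_mem a₀
  obtain ⟨b₁, hb₁, hab₁⟩ := (hK 1 2 (by simp)).exists_add_mem a₁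
  have hb : K 1 = span ℝ {b₀, b₁} := by
    refine (hline 1).eq_span_pair hb₀ hb₁ ?_
    have hli := hline 0
    rw [ha, isLine_span_pair, LinearIndependent.pair_iff] at hli
    rw [isLine_span_pair, LinearIndependent.pair_iff]
    intro x y hxy
    refine hli x y ((hK 0 2 (by simp)).eq_zero ?_ ?_)
    · exact add_mem ((K 0).smul_mem x ha₀) ((K 0).smul_mem y ha₁)
    · have : x • a₀ + y • a₁ = x • (a₀ + b₀) + y • (a₁ + b₁) := by
        rw [← add_zero (x • a₀ + y • a₁), ← hxy]; module
      rw [this]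
      exact add_mem ((K 2).smul_mem x hab₀) ((K 2).smul_mem y hab₁)
  have hgraph : ∀ i, i ≠ 0 → i ≠ 1 → ∃ M : Matrix (Fin 2) (Fin 2) ℝ,
      K i = span ℝ {a₀ + (M 0 0 • b₀ + M 1 0 • b₁), a₁ + (M 0 1 • b₀ + M 1 1 • b₁)} := by
    intro i h0 h1
    obtain ⟨c₀, hc₀, hac₀⟩ := (hK 1 i h1.symm).exists_add_mem a₀
    obtain ⟨c₁, hc₁, hac₁⟩ := (hK 1 i h1.symm).exists_add_mem a₁
    obtain ⟨x, y, hxy⟩ := mem_span_pair.1 (hb ▸ hc₀)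
    obtain ⟨z, w, hzw⟩ := mem_span_pair.1 (hb ▸ hc₁)
    refine ⟨!![x, z; y, w], ?_⟩
    simp only [Matrix.of_apply, Matrix.cons_val, hxy, hzw]
    exact hpair h0 h1 hc₀ hc₁ hac₀ hac₁
  obtain ⟨M, hM⟩ := hgraph 3 (by simp) (by simp)
  obtain ⟨N, hN⟩ := hgraph 4 (by simp) (by simp)
  refine ⟨ofColumns a₀ a₁ b₀ b₁, M, N, ?_, ?_⟩
  · rw [det_ofColumns, ← skew_span_pair_iff, ← ha, ← hb]
    exact hK 0 1 (by simp)
  · ext1 i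
    fin_cases i <;>
      simp [frameLines, mapFrame, graphFrames, ofColumns_mulVec, ha, hb, hM, hN, ← add_assoc]
    simpa using hpair (i := 2) (by simp) (by simp) hb₀ hb₁ hab₀ hab₁

theorem MvPolynomial.IsHomogeneous.exists_eq_sum_X_mul {σ : Type*} [Fintype σ]
    {F : MvPolynomial σ ℝ} {n : ℕ} (hF : F.IsHomogeneous (n + 1)) :
    ∃ H : σ → MvPolynomial σ ℝ, (∀ i, (H i).IsHomogeneous n) ∧ F = ∑ i, X i * H i := by
  refine ⟨fun i => C (1 / (n + 1 : ℝ)) * pderiv i F, fun i => ?_, ?_⟩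
  · have h : (pderiv i F).IsHomogeneous n := hF.pderiv
    simpa using (isHomogeneous_C σ (1 / (n + 1 : ℝ))).mul h
  · have h : C (1 / (n + 1 : ℝ)) * (n + 1 : MvPolynomial σ ℝ) = 1 := by
      have : (n + 1 : MvPolynomial σ ℝ) = C (n + 1 : ℝ) := by simp
      rw [this, ← MvPolynomial.C_mul, one_div_mul_cancel (by positivity), C_1]
    have := hF.sum_X_mul_pderiv
    have hsum : ∑ i, X i * (C (1 / (n + 1 : ℝ)) * pderiv i F) =
        C (1 / (n + 1 : ℝ)) * ∑ i, X i * pderiv i F := by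
      rw [Finset.mul_sum]
      exact Finset.sum_congr rfl fun i _ => mul_left_comm ..
    rw [hsum, this, nsmul_eq_mul, ← mul_assoc]
    push_cast
    rw [h, one_mul]

theorem MvPolynomial.IsHomogeneous.exists_eval_eq_sum {σ : Type*} [Fintype σ]
    {F : MvPolynomial σ ℝ} (hF : F.IsHomogeneous 3) :
    ∃ G : σ → σ → σ → ℝ, ∀ x, eval x F = ∑ i, ∑ j, ∑ k, G i j k * (x i * x j * x k) := by
  obtain ⟨H, hH, rfl⟩ := hF.exists_eq_sum_X_mul
  choose H' hH' hsum using fun i => (hH i).exists_eq_sum_X_mul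
  choose H'' hH'' hsum' using fun i j => (hH' i j).exists_eq_sum_X_mul
  refine ⟨fun i j k => coeff 0 (H'' i j k), fun x => ?_⟩
  have hC : ∀ i j k, H'' i j k = C (coeff 0 (H'' i j k)) := fun i j k =>
    totalDegree_eq_zero_iff_eq_C.1 ((totalDegree_zero_iff_isHomogeneous _).2 (hH'' i j k))
  have hev : ∀ i j k, eval x (H'' i j k) = coeff 0 (H'' i j k) := fun i j k => by
    conv_lhs => rw [hC, eval_C]
  have h1 : ∀ i, H i = ∑ j, X j * ∑ k, X k * H'' i j k := fun i => by
    rw [hsum i]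
    exact Finset.sum_congr rfl fun j _ => by rw [← hsum' i j]
  simp only [h1, map_sum, map_mul, eval_X, hev, Finset.mul_sum]
  refine Finset.sum_congr rfl fun i _ => Finset.sum_congr rfl fun j _ =>
    Finset.sum_congr rfl fun k _ => by ring

theorem binary_cubic_coeffs_eq_zero {p q r s : ℝ}
    (h : ∀ x y : ℝ, p * x ^ 3 + q * x ^ 2 * y + r * x * y ^ 2 + s * y ^ 3 = 0) :
    p = 0 ∧ q = 0 ∧ r = 0 ∧ s = 0 := by
  have := h 1 0; have := h 0 1; have := h 1 1; have := h 1 (-1)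
  refine ⟨?_, ?_, ?_, ?_⟩ <;> linarith

/-- The polarisation `γ(u, u, v) - γ(u, v, v)` of a binary cubic form `γ`, plus a multiple of
`u ∧ v`, at `u = (x, y)` and `v = (z, w)`. -/
def tripleCubic (γ : Fin 4 → ℝ) (α β : Fin 2 → ℝ) (x y z w : ℝ) : ℝ :=
  γ 0 * x ^ 2 * z + γ 1 * (2 * x * y * z + x ^ 2 * w) + γ 2 * (2 * x * y * w + y ^ 2 * z)
    + γ 3 * y ^ 2 * w - (γ 0 * x * z ^ 2 + γ 1 * (2 * x * z * w + y * z ^ 2)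
    + γ 2 * (2 * y * z * w + x * w ^ 2) + γ 3 * y * w ^ 2)
    + (x * w - y * z) * (α 0 * x + α 1 * y + β 0 * z + β 1 * w)

theorem MvPolynomial.IsHomogeneous.exists_eval_mulVec_eq_sum {n : ℕ}
    {F : MvPolynomial (Fin n) ℝ} (hF : F.IsHomogeneous 3) (B : Matrix (Fin n) (Fin n) ℝ) :
    ∃ G : Fin n → Fin n → Fin n → ℝ, ∀ x,
      eval (B.mulVec x) F = ∑ i, ∑ j, ∑ k, G i j k * (x i * x j * x k) := by
  have hhom : (MvPolynomial.aeval (fun i => ∑ j, C (B i j) * X j) F).IsHomogeneous 3 := by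
    simpa only [one_mul] using hF.aeval (g := fun i => ∑ j, C (B i j) * X j) (n := 1) fun i =>
      .sum _ _ _ fun j _ => by simpa using (isHomogeneous_C _ (B i j)).mul (isHomogeneous_X ℝ j)
  obtain ⟨G, hG⟩ := hhom.exists_eval_eq_sum
  refine ⟨G, fun x => ?_⟩
  rw [← hG, ← aeval_eq_eval, ← aeval_eq_eval]
  refine Eq.trans ?_ (comp_aeval_apply _ (MvPolynomial.aeval x) F).symm
  congr 2
  ext i
  simp [Matrix.mulVec, dotProduct]

theorem exists_eq_tripleCubic {G : Fin 4 → Fin 4 → Fin 4 → ℝ} {Φ : V4 → ℝ}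
    (hΦ : ∀ x, Φ x = ∑ i, ∑ j, ∑ k, G i j k * (x i * x j * x k))
    (h₀ : ∀ x y, Φ ![x, y, 0, 0] = 0) (h₁ : ∀ x y, Φ ![0, 0, x, y] = 0)
    (h₂ : ∀ x y, Φ ![x, y, x, y] = 0) :
    ∃ γ α β, ∀ x y z w, Φ ![x, y, z, w] = tripleCubic γ α β x y z w := by
  obtain ⟨p, q, a, b, hpq⟩ : ∃ (p q : Fin 4 → ℝ) (a b : Fin 6 → ℝ), ∀ x y z w,
      Φ ![x, y, z, w] = p 0 * x ^ 3 + p 1 * x ^ 2 * y + p 2 * x * y ^ 2 + p 3 * y ^ 3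
        + q 0 * z ^ 3 + q 1 * z ^ 2 * w + q 2 * z * w ^ 2 + q 3 * w ^ 3
        + a 0 * x ^ 2 * z + a 1 * x ^ 2 * w + a 2 * x * y * z + a 3 * x * y * w
        + a 4 * y ^ 2 * z + a 5 * y ^ 2 * w
        + b 0 * z ^ 2 * x + b 1 * z ^ 2 * y + b 2 * z * w * x + b 3 * z * w * y
        + b 4 * w ^ 2 * x + b 5 * w ^ 2 * y := by
    let s : Fin 4 → Fin 4 → Fin 4 → ℝ := fun i j k => G i j k + G j k i + G k i j
    let t : Fin 4 → Fin 4 → Fin 4 → ℝ := fun i j k => s i j k + s j i k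
    refine ⟨![G 0 0 0, s 0 0 1, s 0 1 1, G 1 1 1], ![G 2 2 2, s 2 2 3, s 2 3 3, G 3 3 3],
      ![s 0 0 2, s 0 0 3, t 0 1 2, t 0 1 3, s 1 1 2, s 1 1 3],
      ![s 0 2 2, s 1 2 2, t 0 2 3, t 1 2 3, s 0 3 3, s 1 3 3], fun x y z w => ?_⟩
    rw [hΦ]
    simp only [Fin.sum_univ_four, Matrix.cons_val, s, t]
    ring
  simp only [hpq] at h₀ h₁ h₂ ⊢
  obtain ⟨hp0, hp1, hp2, hp3⟩ := binary_cubic_coeffs_eq_zero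
    (p := p 0) (q := p 1) (r := p 2) (s := p 3) fun x y => by linear_combination h₀ x y
  obtain ⟨hq0, hq1, hq2, hq3⟩ := binary_cubic_coeffs_eq_zero
    (p := q 0) (q := q 1) (r := q 2) (s := q 3) fun x y => by linear_combination h₁ x y
  simp only [hp0, hp1, hp2, hp3, hq0, hq1, hq2, hq3] at h₂ ⊢
  obtain ⟨h0, h1, h2, h3⟩ := binary_cubic_coeffs_eq_zero (p := a 0 + b 0)
    (q := a 1 + a 2 + b 1 + b 2) (r := a 3 + a 4 + b 3 + b 4) (s := a 5 + b 5)
    fun x y => by linear_combination h₂ x y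
  refine ⟨![a 0, (a 1 + a 2) / 3, (a 3 + a 4) / 3, a 5],
    ![a 1 - (a 1 + a 2) / 3, a 3 - 2 * (a 3 + a 4) / 3],
    ![-(a 1 + a 2) / 3 - b 1, b 4 + (a 3 + a 4) / 3], fun x y z w => ?_⟩
  simp only [tripleCubic, Matrix.cons_val]
  linear_combination z ^ 2 * x * h0 + z * w * x * h1 + z * w * y * h2 + w ^ 2 * y * h3

theorem exists_linear_cofactor {γ : Fin 4 → ℝ} {α β : Fin 2 → ℝ} {a b c d : ℝ}
    (h : ∀ x y, tripleCubic γ α β x y (a * x + b * y) (c * x + d * y) = 0) :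
    ∃ l₀ l₁ : ℝ, ∀ k, (a * d - b * c) * ((1 - a) * (1 - d) - b * c) * γ k =
      ![c * l₀, (c * l₁ + (d - a) * l₀) / 3, ((d - a) * l₁ - b * l₀) / 3, -(b * l₁)] k := by
  obtain ⟨m₀, hm₀⟩ : ∃ m₀, m₀ = α 0 + a * β 0 + c * β 1 := ⟨_, rfl⟩
  obtain ⟨m₁, hm₁⟩ : ∃ m₁, m₁ = α 1 + b * β 0 + d * β 1 := ⟨_, rfl⟩
  obtain ⟨h₀, h₁, h₂, h₃⟩ := binary_cubic_coeffs_eq_zero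
    (p := γ 0 * a + γ 1 * c - (γ 0 * a ^ 2 + γ 1 * (2 * a * c) + γ 2 * c ^ 2) + c * m₀)
    (q := γ 0 * b + γ 1 * (2 * a + d) + γ 2 * (2 * c) - (γ 0 * (2 * a * b)
      + γ 1 * (2 * (a * d + b * c) + a ^ 2) + γ 2 * (2 * a * c + 2 * c * d) + γ 3 * c ^ 2)
      + (c * m₁ + (d - a) * m₀))
    (r := γ 1 * (2 * b) + γ 2 * (2 * d + a) + γ 3 * c - (γ 0 * b ^ 2
      + γ 1 * (2 * b * d + 2 * a * b) + γ 2 * (2 * (a * d + b * c) + d ^ 2) + γ 3 * (2 * c * d))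
      + ((d - a) * m₁ - b * m₀))
    (s := γ 2 * b + γ 3 * d - (γ 1 * b ^ 2 + γ 2 * (2 * b * d) + γ 3 * d ^ 2) - b * m₁)
    fun x y => by
      rw [← h x y, tripleCubic, hm₀, hm₁]
      ring
  refine ⟨2 * γ 1 * b * c + 2 * γ 1 * a - 3 * γ 1 * a * d - 4 * γ 1 * a * b * c - 3 * γ 1 * a ^ 2
      + 3 * γ 1 * a ^ 2 * d + γ 1 * a ^ 3 + 2 * γ 2 * c - γ 2 * c * d - 4 * γ 2 * b * c ^ 2
      - 3 * γ 2 * a * c + 2 * γ 2 * a * c * d + 2 * γ 2 * a ^ 2 * c - γ 3 * c ^ 2 * d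
      + γ 3 * a * c ^ 2 + m₀ * b * c - m₀ * a + m₀ * a ^ 2 + m₁ * c - 2 * m₁ * a * c,
    -2 * γ 1 * a * b * d - 2 * γ 1 * b + γ 1 * b * d + 3 * γ 1 * a * b - 2 * γ 1 * a ^ 2 * b
      - 2 * γ 2 * d + γ 2 * d ^ 2 - 2 * γ 2 * b * c * d + 4 * γ 2 * a * d - 2 * γ 2 * a * d ^ 2
      - 2 * γ 2 * a ^ 2 * d - 2 * γ 2 * a * b * c + γ 2 * a ^ 2 + 2 * γ 2 * b * c + 3 * γ 3 * c * d
      - 2 * γ 3 * c * d ^ 2 - 2 * γ 3 * a * c * d + γ 3 * a * c - m₀ * b * d - m₀ * a * b + m₀ * b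
      - m₁ * d + 2 * m₁ * a * d - m₁ * a ^ 2 - 3 * m₁ * b * c, fun k => ?_⟩
  fin_cases k <;> simp only [Fin.mk_one, Fin.zero_eta, Fin.reduceFinMk, Matrix.cons_val]
  · linear_combination
      (d - d ^ 2 - 2 * b * c) * h₀ + (c * d - c + a * c) * h₁ - c ^ 2 * h₂
  · linear_combination
      ((2 * a * b - b) * h₀ + (a - a ^ 2) * h₁ - 3 * c ^ 2 * h₃) / 3
  · linear_combination
      (b ^ 2 * h₀ + (b * d - a * b) * h₁ + (d - 2 * a * d + a ^ 2) * h₂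
        + (-c - 2 * c * d + 4 * a * c) * h₃) / 3
  · linear_combination
      -b ^ 2 * h₁ + (-b + 2 * a * b) * h₂ + (2 * b * c + a - a ^ 2) * h₃

theorem sylvester_det_eq_zero {a₀ a₁ a₂ b₀ b₁ b₂ l₀ l₁ m₀ m₁ : ℝ}
    (h₀ : a₀ * l₀ = b₀ * m₀) (h₁ : a₀ * l₁ + a₁ * l₀ = b₀ * m₁ + b₁ * m₀)
    (h₂ : a₁ * l₁ + a₂ * l₀ = b₁ * m₁ + b₂ * m₀) (h₃ : a₂ * l₁ = b₂ * m₁)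
    (hl : l₀ ≠ 0 ∨ l₁ ≠ 0) :
    (a₀ * b₂ - a₂ * b₀) ^ 2 =
      (a₀ * b₁ - a₁ * b₀) * (a₁ * b₂ - a₂ * b₁) := by
  have := Matrix.exists_mulVec_eq_zero_iff.1 ⟨![l₀, l₁, -m₀, -m₁], by
    contrapose! hl
    exact ⟨congrFun hl 0, congrFun hl 1⟩, show Matrix.mulVec
      (Matrix.of ![![a₀, 0, b₀, 0], ![a₁, a₀, b₁, b₀],
        ![a₂, a₁, b₂, b₁], ![0, a₂, 0, b₂]]) _ = 0 by
    ext i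
    fin_cases i <;> simp [Matrix.mulVec, dotProduct, Fin.sum_univ_four] <;> linarith⟩
  rw [show Matrix.det _ = det2 _ _ _ _ from rfl, det2_eq] at this
  simp at this
  linear_combination this

theorem coeffs_eq_zero_of_quadratic_mul_linear_eq_zero {b c e l₀ l₁ : ℝ} (h₀ : c * l₀ = 0)
    (h₁ : c * l₁ + e * l₀ = 0) (h₂ : e * l₁ - b * l₀ = 0) (h₃ : -b * l₁ = 0) :
    (b = 0 ∧ c = 0 ∧ e = 0) ∨ (l₀ = 0 ∧ l₁ = 0) := by
  by_cases hl : l₀ = 0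
  · by_cases hl' : l₁ = 0 <;> simp_all
  · obtain rfl : c = 0 := by simpa [hl] using h₀
    obtain rfl : e = 0 := by simpa [hl] using h₁
    simp_all

theorem det_commutator_eq_zero {γ : Fin 4 → ℝ} {α β : Fin 2 → ℝ}
    {M N : Matrix (Fin 2) (Fin 2) ℝ} (hM : M.det ≠ 0) (hM₁ : (M - 1).det ≠ 0) (hN : N.det ≠ 0)
    (hN₁ : (N - 1).det ≠ 0) (hMN : (M - N).det ≠ 0)
    (hΦM : ∀ x y, tripleCubic γ α β x y (M 0 0 * x + M 0 1 * y) (M 1 0 * x + M 1 1 * y) = 0)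
    (hΦN : ∀ x y, tripleCubic γ α β x y (N 0 0 * x + N 0 1 * y) (N 1 0 * x + N 1 1 * y) = 0)
    (hΦ : ∃ x y z w, tripleCubic γ α β x y z w ≠ 0) : (M * N - N * M).det = 0 := by
  have hcomm : (M * N - N * M).det = (M 1 0 * (N 1 1 - N 0 0) - (M 1 1 - M 0 0) * N 1 0) *
      (M 0 1 * (N 1 1 - N 0 0) - (M 1 1 - M 0 0) * N 0 1) -
      (M 1 0 * N 0 1 - M 0 1 * N 1 0) ^ 2 := by
    simp [Matrix.det_fin_two, Matrix.mul_apply]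
    ring
  rw [hcomm]
  simp [Matrix.det_fin_two] at hM hM₁ hN hN₁ hMN
  by_cases hγ : γ = 0
  · have key : ∀ a b c d : ℝ, (∀ x y, tripleCubic γ α β x y (a * x + b * y) (c * x + d * y) = 0) →
        (b = 0 ∧ c = 0 ∧ d - a = 0) ∨
          (α 0 + a * β 0 + c * β 1 = 0 ∧ α 1 + b * β 0 + d * β 1 = 0) := by
      intro a b c d h
      obtain ⟨h₀, h₁, h₂, h₃⟩ := binary_cubic_coeffs_eq_zero
        (p := c * (α 0 + a * β 0 + c * β 1))
        (q := c * (α 1 + b * β 0 + d * β 1) + (d - a) * (α 0 + a * β 0 + c * β 1))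
        (r := (d - a) * (α 1 + b * β 0 + d * β 1) - b * (α 0 + a * β 0 + c * β 1))
        (s := -b * (α 1 + b * β 0 + d * β 1)) fun x y => by
          rw [← h x y, tripleCubic, hγ]
          simp
          ring
      exact coeffs_eq_zero_of_quadratic_mul_linear_eq_zero h₀ h₁ h₂ h₃
    rcases key _ _ _ _ hΦM with ⟨h1, h2, h3⟩ | ⟨h1, h2⟩
    · simp [h1, h2, h3]
    rcases key _ _ _ _ hΦN with ⟨h3, h4, h5⟩ | ⟨h3, h4⟩
    · simp [h3, h4, h5]
    obtain ⟨x, y, z, w, h⟩ := hΦ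
    have hβ₀ : β 0 = 0 := by grind
    have hβ₁ : β 1 = 0 := by grind
    simp [hβ₀, hβ₁] at h1 h2
    simp [tripleCubic, hγ, hβ₀, hβ₁, h1, h2] at h
  · obtain ⟨k, hk⟩ : ∃ k, γ k ≠ 0 := Function.ne_iff.1 hγ
    obtain ⟨l₀, l₁, hl⟩ := exists_linear_cofactor hΦM
    obtain ⟨m₀, m₁, hm⟩ := exists_linear_cofactor hΦN
    obtain ⟨κ, hκ⟩ : ∃ κ, κ = (M 0 0 * M 1 1 - M 0 1 * M 1 0) *
      ((1 - M 0 0) * (1 - M 1 1) - M 0 1 * M 1 0) := ⟨_, rfl⟩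
    obtain ⟨κ', hκ'⟩ : ∃ κ', κ' = (N 0 0 * N 1 1 - N 0 1 * N 1 0) *
      ((1 - N 0 0) * (1 - N 1 1) - N 0 1 * N 1 0) := ⟨_, rfl⟩
    have hκ0 : κ ≠ 0 := by
      rw [hκ]
      refine mul_ne_zero hM ?_
      convert hM₁ using 1
      ring
    have hκ'0 : κ' ≠ 0 := by
      rw [hκ']
      refine mul_ne_zero hN ?_
      convert hN₁ using 1
      ring
    rw [← hκ] at hl
    rw [← hκ'] at hm
    have hl' : l₀ ≠ 0 ∨ l₁ ≠ 0 := by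
      by_contra! h
      have := hl k
      rw [h.1, h.2] at this
      have h0 : κ * γ k = 0 := by fin_cases k <;> simpa using this
      exact mul_ne_zero hκ0 hk h0
    have := sylvester_det_eq_zero (a₀ := M 1 0) (a₁ := M 1 1 - M 0 0) (a₂ := -M 0 1)
      (b₀ := N 1 0) (b₁ := N 1 1 - N 0 0) (b₂ := -N 0 1) (l₀ := κ' * l₀) (l₁ := κ' * l₁) (m₀ := κ * m₀)
      (m₁ := κ * m₁) ?_ ?_ ?_ ?_ (by simpa [hκ'0] using hl')
    · linear_combination -this
    all_goals
      have hl0 := hl 0; have hl1 := hl 1; have hl2 := hl 2; have hl3 := hl 3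
      have hm0 := hm 0; have hm1 := hm 1; have hm2 := hm 2; have hm3 := hm 3
      simp only [Matrix.cons_val] at hl0 hl1 hl2 hl3 hm0 hm1 hm2 hm3
    · linear_combination κ * hm0 - κ' * hl0
    · linear_combination 3 * κ * hm1 - 3 * κ' * hl1
    · linear_combination 3 * κ * hm2 - 3 * κ' * hl2
    · linear_combination κ * hm3 - κ' * hl3

theorem exists_eq_smul_of_mul_eq_mul {u v : Fin 2 → ℝ} (hu : u ≠ 0) (h : u 0 * v 1 = u 1 * v 0) :
    ∃ r : ℝ, v = r • u := by
  by_cases hu0 : u 0 = 0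
  · have hu1 : u 1 ≠ 0 := fun hu1 => hu (by ext i; fin_cases i <;> assumption)
    refine ⟨v 1 / u 1, ?_⟩
    ext i
    fin_cases i <;> simp [hu0, hu1] at h ⊢
    exact h
  · refine ⟨v 0 / u 0, ?_⟩
    ext i
    fin_cases i <;> simp <;> field_simp
    linear_combination h

theorem exists_mulVec_eq_smul_of_commutator {M N : Matrix (Fin 2) (Fin 2) ℝ}
    (hMN : M * N - N * M ≠ 0) {u : Fin 2 → ℝ} (hu : u ≠ 0)
    (h : (M * N - N * M).mulVec u = 0) : ∃ r : ℝ, M.mulVec u = r • u := by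
  obtain ⟨C, hC⟩ : ∃ C, C = M * N - N * M := ⟨_, rfl⟩
  have hCM : C * M = M.trace • C - M * C := by
    rw [hC]
    ext i j
    fin_cases i <;> fin_cases j <;>
      simp [Matrix.mul_apply, Matrix.trace, Fin.sum_univ_two] <;> ring
  rw [← hC] at hMN h
  have h' : C.mulVec (M.mulVec u) = 0 := by
    rw [Matrix.mulVec_mulVec, hCM, Matrix.sub_mulVec, Matrix.smul_mulVec, ← Matrix.mulVec_mulVec,
      h, smul_zero, Matrix.mulVec_zero, sub_zero]
  refine exists_eq_smul_of_mul_eq_mul hu ?_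
  obtain ⟨i, hi⟩ : ∃ i, C i ≠ 0 := Function.ne_iff.1 hMN
  have h1 := congrFun h i
  have h2 := congrFun h' i
  obtain ⟨v, hv⟩ : ∃ v, v = M.mulVec u := ⟨_, rfl⟩
  rw [← hv] at h2 ⊢
  simp only [Matrix.mulVec, dotProduct, Fin.sum_univ_two, Pi.zero_apply] at h1 h2
  have hi' : C i 0 ≠ 0 ∨ C i 1 ≠ 0 := by
    by_contra! h0
    exact hi (by ext j; fin_cases j; exacts [h0.1, h0.2])
  rcases hi' with h0 | h0 <;> refine mul_left_cancel₀ h0 ?_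
  · linear_combination v 1 * h1 - u 1 * h2
  · linear_combination u 0 * h2 - v 0 * h1

theorem exists_eigenvector_or_forall_det_ne_zero (X : Matrix (Fin 2) (Fin 2) ℝ) :
    (∃ u ≠ 0, ∃ r : ℝ, X.mulVec u = r • u) ∨
      ∀ p q : ℝ, p ≠ 0 ∨ q ≠ 0 → (p • 1 + q • X).det ≠ 0 := by
  by_contra! ⟨hX, p, q, hpq, h⟩
  obtain ⟨u, hu, h0⟩ := Matrix.exists_mulVec_eq_zero_iff.2 h
  simp only [Matrix.add_mulVec, Matrix.smul_mulVec, Matrix.one_mulVec] at h0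
  have hq : q ≠ 0 := by
    rintro rfl
    simp_all
  refine hX u hu (-(p / q)) ?_
  rw [add_eq_zero_iff_eq_neg'] at h0
  rw [neg_smul, div_eq_inv_mul, mul_smul, ← smul_neg, ← h0, inv_smul_smul₀ hq]

theorem exists_eq_pencil_of_mul_comm {M N : Matrix (Fin 2) (Fin 2) ℝ} (h : M * N - N * M = 0) :
    ∃ (X : Matrix (Fin 2) (Fin 2) ℝ) (p q p' q' : ℝ), M = p • 1 + q • X ∧ N = p' • 1 + q' • X := by
  have h00 := congrFun₂ h 0 0
  have h01 := congrFun₂ h 0 1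
  have h10 := congrFun₂ h 1 0
  simp [Matrix.mul_apply] at h00 h01 h10
  by_cases hM : M 0 1 = 0 ∧ M 1 0 = 0 ∧ M 1 1 = M 0 0
  · refine ⟨N, M 0 0, 0, 0, 1, ?_, by simp⟩
    ext i j
    fin_cases i <;> fin_cases j <;> simp [hM]
  · obtain ⟨q, h1, h2, h3⟩ : ∃ q, N 0 1 = q * M 0 1 ∧ N 1 0 = q * M 1 0 ∧
        N 1 1 - N 0 0 = q * (M 1 1 - M 0 0) := by
      by_cases hb : M 0 1 = 0
      · by_cases hc : M 1 0 = 0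
        · have he : M 1 1 - M 0 0 ≠ 0 := fun he => hM ⟨hb, hc, sub_eq_zero.1 he⟩
          refine ⟨(N 1 1 - N 0 0) / (M 1 1 - M 0 0), ?_, ?_, ?_⟩ <;> field_simp
          · linear_combination -h01
          · linear_combination h10
        · refine ⟨N 1 0 / M 1 0, ?_, ?_, ?_⟩ <;> field_simp
          · linear_combination -h00
          · linear_combination -h10
      · refine ⟨N 0 1 / M 0 1, ?_, ?_, ?_⟩ <;> field_simp
        · linear_combination h00
        · linear_combination h01
    refine ⟨M, 0, 1, N 0 0 - q * M 0 0, q, by simp, ?_⟩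
    ext i j
    fin_cases i <;> fin_cases j <;> simp <;> linarith

theorem exists_eigenvector_or_eq_pencil {M N : Matrix (Fin 2) (Fin 2) ℝ}
    (h : (M * N - N * M).det = 0) :
    (∃ u ≠ 0, ∃ r r' : ℝ, M.mulVec u = r • u ∧ N.mulVec u = r' • u) ∨
      ∃ (X : Matrix (Fin 2) (Fin 2) ℝ) (p q p' q' : ℝ),
        (∀ p q : ℝ, p ≠ 0 ∨ q ≠ 0 → (p • 1 + q • X).det ≠ 0) ∧
          M = p • 1 + q • X ∧ N = p' • 1 + q' • X := by
  by_cases hMN : M * N - N * M = 0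
  · obtain ⟨X, p, q, p', q', hM, hN⟩ := exists_eq_pencil_of_mul_comm hMN
    refine (exists_eigenvector_or_forall_det_ne_zero X).imp ?_ fun hX => ⟨X, p, q, p', q', hX, hM, hN⟩
    rintro ⟨u, hu, r, hr⟩
    refine ⟨u, hu, p + q * r, p' + q' * r, ?_, ?_⟩
    · simp [hM, Matrix.add_mulVec, Matrix.smul_mulVec, hr, add_smul, mul_smul]
    · simp [hN, Matrix.add_mulVec, Matrix.smul_mulVec, hr, add_smul, mul_smul]
  · obtain ⟨u, hu, h0⟩ := Matrix.exists_mulVec_eq_zero_iff.2 h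
    obtain ⟨r, hr⟩ := exists_mulVec_eq_smul_of_commutator hMN hu h0
    obtain ⟨r', hr'⟩ := exists_mulVec_eq_smul_of_commutator (M := N) (N := M)
      (by rwa [← neg_sub, neg_ne_zero]) hu (by rw [← neg_sub, Matrix.neg_mulVec, h0, neg_zero])
    exact .inl ⟨u, hu, r, r', hr, hr'⟩

theorem det_commutator_eq_zero_of_cubic {B : Matrix (Fin 4) (Fin 4) ℝ} (hB : B.det ≠ 0)
    {M N : Matrix (Fin 2) (Fin 2) ℝ} (h : graphFrames M N ∈ skewFrames 5)
    {F : MvPolynomial (Fin 4) ℝ} (hF0 : F ≠ 0) (hF : F.IsHomogeneous 3)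
    (hFK : ∀ i, ∀ x ∈ frameLines (mapFrame B (graphFrames M N)) i, MvPolynomial.eval x F = 0) :
    (M * N - N * M).det = 0 := by
  have hvan : ∀ (i : Fin 5) (x y : ℝ),
      MvPolynomial.eval (B.mulVec (x • (graphFrames M N i).1 + y • (graphFrames M N i).2)) F = 0 := by
    intro i x y
    refine hFK i _ (mem_span_pair.2 ⟨x, y, ?_⟩)
    simp [mapFrame, Matrix.mulVec_add, Matrix.mulVec_smul]
  obtain ⟨G, hG⟩ := hF.exists_eval_mulVec_eq_sum B
  obtain ⟨γ, α, β, hγ⟩ := exists_eq_tripleCubic hG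
    (fun x y => by simpa [graphFrames] using hvan 0 x y)
    (fun x y => by simpa [graphFrames] using hvan 1 x y)
    (fun x y => by simpa [graphFrames] using hvan 2 x y)
  obtain ⟨hM, hM₁, hN, hN₁, hMN⟩ := (graphFrames_mem_skewFrames_iff M N).1 h
  refine det_commutator_eq_zero (γ := γ) (α := α) (β := β) hM hM₁ hN hN₁ hMN ?_ ?_ ?_
  · intro x y
    rw [← hγ]
    simpa [graphFrames, mul_comm] using hvan 3 x y
  · intro x y
    rw [← hγ]
    simpa [graphFrames, mul_comm] using hvan 4 x y
  · obtain ⟨v, hv⟩ : ∃ v, MvPolynomial.eval v F ≠ 0 := by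
      contrapose! hF0
      exact MvPolynomial.funext fun v => by simp [hF0 v]
    obtain ⟨w, rfl⟩ := exists_mulVec_eq hB v
    refine ⟨w 0, w 1, w 2, w 3, ?_⟩
    rw [← hγ]
    convert hv
    ext i
    fin_cases i <;> rfl

theorem schlafli_sub5_is_join (L : Fin 6 → PLine) (hL : IsSchlafliSix L) (i : Fin 6) :
    ∃ σ : Equiv.Perm (Fin 5), DeformEquiv (L ∘ i.succAbove) (joinConfig σ) := by
  obtain ⟨hskew, F, hF0, hF, hFL, -⟩ := hL
  have hK : PairwiseSkew (L ∘ i.succAbove) := fun j k hjk =>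
    hskew _ _ (i.succAbove_right_injective.ne hjk)
  have hFK : ∀ j, ∀ x ∈ (L ∘ i.succAbove) j, MvPolynomial.eval x F = 0 := fun j => hFL _
  obtain ⟨B, M, N, hB, h⟩ := exists_eq_frameLines_mapFrame_graphFrames hK
  rw [h] at hK hFK ⊢
  have hgraph := (mapFrame_mem_skewFrames_iff hB).1 ((pairwiseSkew_frameLines_iff _).1 hK)
  rcases exists_eigenvector_or_eq_pencil (det_commutator_eq_zero_of_cubic hB hgraph hF0 hF hFK) with
    ⟨u, hu, r, r', hM, hN⟩ | ⟨X, p, q, p', q', hX, rfl, rfl⟩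
  · exact exists_deformEquiv_of_eigenvector hB hgraph hu hM hN
  · exact exists_deformEquiv_of_pencil hB hX hgraph
end

section
/- (Spindle configurations are joins) Let n≥2 and let {L₁,…,Lₙ} be n pairwise skew lines in RP³ that all meet a common transversal line A (i.e., A is a line with dim(A∩Lᵢ)=1 for every i). Then there exists a permutation σ of {1,…,n} such that {L₁,…,Lₙ} is deformation equivalent to the join configuration J(σ). -/
open Submodule

/-- The line spanned by `(1, u, 0, 0)` and `(p, q, v, 1)`. -/
noncomputable def normalLine (u v p q : ℝ) : PLine := span ℝ {![1, u, 0, 0], ![p, q, v, 1]}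

lemma isLine_normalLine (u v p q : ℝ) : IsLine (normalLine u v p q) := by
  have h : LinearIndependent ℝ ![(![1, u, 0, 0] : V4), ![p, q, v, 1]] := by
    rw [LinearIndependent.pair_iff]
    intro s t hst
    have h0 := congrFun hst 0
    have h3 := congrFun hst 3
    simp at h0 h3
    subst h3
    simpa using h0
  have := finrank_span_eq_card h
  rwa [Matrix.range_cons_cons_empty, Fintype.card_fin] at this

lemma skew_normalLine {u v p q u' v' p' q' : ℝ} (hu : u ≠ u') (hv : v ≠ v') :
    Skew (normalLine u v p q) (normalLine u' v' p' q') := by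
  refine ⟨isLine_normalLine _ _ _ _, isLine_normalLine _ _ _ _, ?_⟩
  rw [Submodule.eq_bot_iff]
  rintro x ⟨hx, hx'⟩
  obtain ⟨a, b, rfl⟩ := mem_span_pair.1 hx
  obtain ⟨c, d, h⟩ := mem_span_pair.1 hx'
  have h0 := congrFun h 0
  have h1 := congrFun h 1
  have h2 := congrFun h 2
  have h3 := congrFun h 3
  simp at h0 h1 h2 h3
  subst h3
  have hd : d = 0 := by
    by_contra hd
    exact hv (mul_left_cancel₀ hd h2).symm
  subst hd
  simp at h0 h1
  subst h0
  have hc : c = 0 := by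
    by_contra hc
    exact hu (mul_left_cancel₀ hc h1).symm
  simp [hc]

lemma ne_of_skew_normalLine {u v p q u' v' p' q' : ℝ}
    (h : Skew (normalLine u v p q) (normalLine u' v' p' q')) : u ≠ u' ∧ v ≠ v' := by
  obtain ⟨-, -, h⟩ := h
  rw [Submodule.eq_bot_iff] at h
  have hu : u ≠ u' := by
    rintro rfl
    have := congrFun (h ![1, u, 0, 0] ⟨subset_span (by simp), subset_span (by simp)⟩) 0
    simp at this
  refine ⟨hu, ?_⟩
  rintro rfl
  have hsub : u - u' ≠ 0 := sub_ne_zero.2 hu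
  set s : ℝ := ((q' - q) - u' * (p' - p)) / (u - u') with hs
  have hs' : s * (u - u') = (q' - q) - u' * (p' - p) := by rw [hs]; field_simp
  have := congrFun (h (s • ![1, u, 0, 0] + (1 : ℝ) • ![p, q, v, 1])
    ⟨mem_span_pair.2 ⟨s, 1, rfl⟩, mem_span_pair.2 ⟨s - (p' - p), 1, by
      ext i
      fin_cases i
      · simp; ring
      · simp; linarith
      · simp
      · simp⟩⟩) 3
  simp at this

lemma finrank_map_of_injective {f : V4 →ₗ[ℝ] V4} (hf : Function.Injective f) (P : PLine) :
    Module.finrank ℝ (P.map f) = Module.finrank ℝ P :=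
  (Submodule.equivMapOfInjective f hf P).finrank_eq.symm

lemma Skew.map {P Q : PLine} (h : Skew P Q) {f : V4 →ₗ[ℝ] V4} (hf : Function.Injective f) :
    Skew (P.map f) (Q.map f) := by
  obtain ⟨hP, hQ, hPQ⟩ := h
  refine ⟨(finrank_map_of_injective hf P).trans hP, (finrank_map_of_injective hf Q).trans hQ, ?_⟩
  rw [← Submodule.map_inf _ hf, hPQ, Submodule.map_bot]

/-- An invertible real matrix is joined to the identity through invertible matrices, up to
rescaling its columns. -/
lemma exists_path_mul_diagonal_one {m : Type*} [Fintype m] [DecidableEq m]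
    (M : Matrix m m ℝ) (hM : M.det ≠ 0) :
    ∃ (d : m → ℝ) (h : ℝ → Matrix m m ℝ), (∀ i, d i ≠ 0) ∧ Continuous h ∧
      h 0 = M * Matrix.diagonal d ∧ h 1 = 1 ∧ ∀ t, (h t).det ≠ 0 := by
  obtain ⟨T, T', D, rfl⟩ := Matrix.Pivot.exists_list_transvec_mul_diagonal_mul_list_transvec M
  let γ : List (Matrix.TransvectionStruct m ℝ) → ℝ → Matrix m m ℝ := fun T t =>
    (T.map fun S => Matrix.transvection S.i S.j ((1 - t) * S.c)).prod
  have hγ : ∀ T, Continuous (γ T) := by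
    intro T
    induction T with
    | nil => simpa [γ] using continuous_const
    | cons S T ih =>
      have hS : Continuous fun t : ℝ => Matrix.transvection S.i S.j ((1 - t) * S.c) := by
        refine continuous_const.add (continuous_matrix fun i j => ?_)
        simp only [Matrix.single, Matrix.of_apply]
        split_ifs <;> fun_prop
      exact hS.matrix_mul ih
  have hdet : ∀ T t, (γ T t).det = 1 := by
    intro T t
    induction T with
    | nil => simp [γ]
    | cons S T ih =>
      simp only [γ, List.map_cons, List.prod_cons, Matrix.det_mul] at ih ⊢
      rw [ih, Matrix.det_transvection_of_ne _ _ S.hij, one_mul]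
  have h0 : ∀ T, γ T 0 = (T.map Matrix.TransvectionStruct.toMatrix).prod := by
    intro T
    simp only [γ, sub_zero, one_mul]
    rfl
  have h1 : ∀ T, γ T 1 = 1 := by
    intro T
    simp [γ]
  have hD : ∀ i, D i ≠ 0 := by
    simpa [← h0, Matrix.det_mul, hdet, Finset.prod_eq_zero_iff] using hM
  have hDD : Matrix.diagonal D * Matrix.diagonal (fun i => (D i)⁻¹) = 1 := by
    simp [Matrix.diagonal_mul_diagonal, hD]
  refine ⟨fun i => (D i)⁻¹, fun t => γ T t * Matrix.diagonal D * γ T' t *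
    Matrix.diagonal fun i => (D i)⁻¹, fun i => inv_ne_zero (hD i), ?_, ?_, ?_, ?_⟩
  · exact (((hγ T).mul continuous_const).mul (hγ T')).mul continuous_const
  · simp [h0]
  · simp [h1, hDD]
  · intro t
    simp [Matrix.det_mul, hdet, Finset.prod_eq_zero_iff, hD]

lemma exists_equiv_mem_iff {A : PLine} (hA : IsLine A) :
    ∃ e : V4 ≃ₗ[ℝ] V4, ∀ x, x ∈ A ↔ e x 2 = 0 ∧ e x 3 = 0 := by
  obtain ⟨C, hC⟩ := Submodule.exists_isCompl A
  have hC2 : Module.finrank ℝ C = 2 := by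
    have := Submodule.finrank_add_eq_of_isCompl hC
    have h2 : Module.finrank ℝ A = 2 := hA
    simp at this
    omega
  let bA := Module.finBasisOfFinrankEq ℝ A hA
  let bC := Module.finBasisOfFinrankEq ℝ C hC2
  let b : Module.Basis (Fin 4) ℝ V4 :=
    ((bA.prod bC).map (Submodule.prodEquivOfIsCompl A C hC)).reindex finSumFinEquiv
  refine ⟨b.equivFun, fun x => ?_⟩
  rw [← Submodule.prodEquivOfIsCompl_symm_apply_snd_eq_zero A C hC,
    ← bC.repr.map_eq_zero_iff, Finsupp.ext_iff, Fin.forall_fin_two]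
  have h2 : (2 : Fin 4) = finSumFinEquiv (m := 2) (n := 2) (Sum.inr 0) := rfl
  have h3 : (3 : Fin 4) = finSumFinEquiv (m := 2) (n := 2) (Sum.inr 1) := rfl
  simp [b, h2, h3]

lemma exists_forall_add_mul_ne_zero {ι : Type*} [Finite ι] (x y : ι → ℝ)
    (h : ∀ i, x i ≠ 0 ∨ y i ≠ 0) : ∃ c : ℝ, ∀ i, x i + c * y i ≠ 0 := by
  obtain ⟨c, hc⟩ := (Set.finite_range fun i => -x i / y i).exists_notMem
  refine ⟨c, fun i hi => ?_⟩
  rcases eq_or_ne (y i) 0 with hy | hy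
  · have := h i
    simp_all
  · exact hc ⟨i, by field_simp; linarith⟩

/-- The shear `(x, y, z, w) ↦ (x + a y, y, z, w + b z)`. -/
def shear (a b : ℝ) : V4 ≃ₗ[ℝ] V4 where
  toFun x := ![x 0 + a * x 1, x 1, x 2, x 3 + b * x 2]
  invFun x := ![x 0 - a * x 1, x 1, x 2, x 3 - b * x 2]
  map_add' x y := by
    ext i
    fin_cases i <;> simp <;> ring
  map_smul' c x := by
    ext i
    fin_cases i <;> simp <;> ring
  left_inv x := by
    ext i
    fin_cases i <;> simp
  right_inv x := by
    ext i
    fin_cases i <;> simp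

lemma exists_equiv_forall_normalizable {n : ℕ} {L : Fin n → PLine} (hL : ∀ i, IsLine (L i))
    {A : PLine} (hA : IsLine A) (hmeet : ∀ i, Module.finrank ℝ ↥(A ⊓ L i) = 1) :
    ∃ e : V4 ≃ₗ[ℝ] V4, ∀ i, (∃ a ∈ L i, e a 0 ≠ 0 ∧ e a 2 = 0 ∧ e a 3 = 0) ∧
      ∃ b ∈ L i, e b 3 ≠ 0 := by
  obtain ⟨e, he⟩ := exists_equiv_mem_iff hA
  have ha : ∀ i, ∃ a ∈ L i, a ∈ A ∧ a ≠ 0 := by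
    intro i
    have : A ⊓ L i ≠ ⊥ := by
      intro h
      have := hmeet i
      rw [h, finrank_bot] at this
      exact zero_ne_one this
    obtain ⟨a, ha, h0⟩ := Submodule.exists_mem_ne_zero_of_ne_bot this
    exact ⟨a, ha.2, ha.1, h0⟩
  have hb : ∀ i, ∃ b ∈ L i, b ∉ A := by
    intro i
    by_contra! h
    have h1 := hmeet i
    have h2 : Module.finrank ℝ (L i) = 2 := hL i
    rw [inf_eq_right.2 h] at h1
    omega
  choose a haL haA ha0 using ha
  choose b hbL hbA using hb
  obtain ⟨c, hc⟩ := exists_forall_add_mul_ne_zero (fun i => e (a i) 0) (fun i => e (a i) 1) (by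
    intro i
    by_contra! h
    refine ha0 i (e.map_eq_zero_iff.1 ?_)
    ext j
    have := (he _).1 (haA i)
    fin_cases j <;> simp_all)
  obtain ⟨d, hd⟩ := exists_forall_add_mul_ne_zero (fun i => e (b i) 3) (fun i => e (b i) 2) (by
    intro i
    by_contra! h
    exact hbA i ((he _).2 h.symm))
  refine ⟨e.trans (shear c d), fun i => ⟨⟨a i, haL i, ?_⟩, b i, hbL i, ?_⟩⟩
  · have := (he _).1 (haA i)
    exact ⟨by simpa [shear] using hc i, by simp [shear, this], by simp [shear, this]⟩
  · simpa [shear] using hd i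

/-- A line containing suitable vectors is the image of a normal line. -/
lemma eq_map_normalLine {P : PLine} (hP : IsLine P) (e : V4 ≃ₗ[ℝ] V4)
    {a b : V4} (ha : a ∈ P) (hb : b ∈ P) (ha0 : e a 0 ≠ 0) (ha2 : e a 2 = 0) (ha3 : e a 3 = 0)
    (hb3 : e b 3 ≠ 0) :
    ∃ u v p q, P = (normalLine u v p q).map (e.symm : V4 →ₗ[ℝ] V4) := by
  refine ⟨e a 1 / e a 0, e b 2 / e b 3, e b 0 / e b 3, e b 1 / e b 3, ?_⟩
  symm
  apply Submodule.eq_of_le_of_finrank_eq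
  · rw [normalLine, Submodule.map_span_le]
    simp only [Set.mem_insert_iff, Set.mem_singleton_iff, forall_eq_or_imp, forall_eq]
    constructor
    · convert P.smul_mem (e a 0)⁻¹ ha
      rw [LinearEquiv.coe_coe, LinearEquiv.symm_apply_eq, map_smul]
      ext i
      fin_cases i <;> simp [*]
      field_simp
    · convert P.smul_mem (e b 3)⁻¹ hb
      rw [LinearEquiv.coe_coe, LinearEquiv.symm_apply_eq, map_smul]
      ext i
      fin_cases i <;> simp [*] <;> field_simp
  · rw [finrank_map_of_injective e.symm.injective]
    exact (isLine_normalLine _ _ _ _).trans hP.symm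

lemma exists_path_forall_eq_map_normalLine {n : ℕ} {L : Fin n → PLine} (hL : ∀ i, IsLine (L i))
    {A : PLine} (hA : IsLine A) (hmeet : ∀ i, Module.finrank ℝ ↥(A ⊓ L i) = 1) :
    ∃ (h : ℝ → Matrix (Fin 4) (Fin 4) ℝ) (u v p q : Fin n → ℝ), Continuous h ∧ h 1 = 1 ∧
      (∀ t, (h t).det ≠ 0) ∧
      ∀ i, L i = (normalLine (u i) (v i) (p i) (q i)).map (h 0).mulVecLin := by
  obtain ⟨e, he⟩ := exists_equiv_forall_normalizable hL hA hmeet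
  obtain ⟨d, h, hd, hc, h0, h1, hdet⟩ := exists_path_mul_diagonal_one
    (LinearMap.toMatrix' (e.symm : V4 →ₗ[ℝ] V4)) (by
      rw [LinearMap.det_toMatrix']
      exact e.symm.isUnit_det'.ne_zero)
  let D : V4 ≃ₗ[ℝ] V4 := LinearEquiv.piCongrRight fun i =>
    LinearEquiv.smulOfNeZero ℝ ℝ (d i)⁻¹ (inv_ne_zero (hd i))
  have hD : ∀ x i, D x i = (d i)⁻¹ * x i := fun x i => rfl
  have key : ((e.trans D).symm : V4 →ₗ[ℝ] V4) = (h 0).mulVecLin := by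
    refine LinearMap.ext fun x => ?_
    rw [LinearEquiv.coe_coe, LinearEquiv.symm_apply_eq, h0, Matrix.mulVecLin_apply,
      ← Matrix.mulVec_mulVec, LinearMap.toMatrix'_mulVec]
    ext i
    simp [hD, Matrix.mulVec_diagonal, hd]
  have hN : ∀ i, ∃ u v p q, L i = (normalLine u v p q).map (h 0).mulVecLin := by
    intro i
    obtain ⟨⟨a, haL, ha0, ha2, ha3⟩, b, hbL, hb3⟩ := he i
    rw [← key]
    apply eq_map_normalLine (hL i) (e.trans D) haL hbL <;> simp [*]
  choose u v p q hN using hN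
  exact ⟨h, u, v, p, q, hc, h1, hdet, hN⟩

lemma exists_perm_strictMono_comp {n : ℕ} {u : Fin n → ℝ} (hu : Function.Injective u) :
    ∃ π : Equiv.Perm (Fin n), StrictMono (u ∘ π) :=
  ⟨Tuple.sort u, (Tuple.monotone_sort u).strictMono_of_injective
    (hu.comp (Equiv.injective _))⟩

lemma interpolate_ne {n : ℕ} {u : Fin n → ℝ} {τ : Fin n → Fin n} (hτ : Function.Injective τ)
    (h : ∀ i j, τ i < τ j → u i < u j) {t : ℝ} (ht : t ∈ Set.Icc (0 : ℝ) 1) {i j : Fin n}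
    (hij : i ≠ j) :
    (1 - t) * u i + t * ((τ i).val + 1) ≠ (1 - t) * u j + t * ((τ j).val + 1) := by
  wlog hlt : τ i < τ j generalizing i j
  · exact (this hij.symm ((not_lt.1 hlt).lt_of_ne fun h => hij.symm (hτ h))).symm
  have h1 := h i j hlt
  have h2 : ((τ i).val : ℝ) < (τ j).val := by exact_mod_cast hlt
  obtain ⟨ht0, ht1⟩ := ht
  rcases eq_or_lt_of_le ht1 with rfl | ht1
  · intro h; linarith
  · have := mul_lt_mul_of_pos_left h1 (sub_pos.2 ht1)
    have := mul_le_mul_of_nonneg_left h2.le ht0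
    intro h; linarith

theorem spindle_is_join {n : ℕ} (hn : 2 ≤ n) (L : Fin n → PLine) (hL : PairwiseSkew L)
    (A : PLine) (hA : IsLine A) (hmeet : ∀ i : Fin n, Module.finrank ℝ ↥(A ⊓ L i) = 1) :
    ∃ σ : Equiv.Perm (Fin n), DeformEquiv L (joinConfig σ) := by
  have hline : ∀ i, IsLine (L i) := by
    intro i
    have : Nontrivial (Fin n) := Fin.nontrivial_iff_two_le.2 hn
    obtain ⟨j, hj⟩ := exists_ne i
    exact (hL i j hj.symm).1
  obtain ⟨h, u, v, p, q, hc, h1, hdet, hN⟩ := exists_path_forall_eq_map_normalLine hline hA hmeet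
  have hinj : ∀ t, Function.Injective (h t).mulVecLin := fun t =>
    Matrix.mulVec_injective_iff_isUnit.2 ((Matrix.isUnit_iff_isUnit_det _).2 (hdet t).isUnit)
  have hne : ∀ i j, i ≠ j → u i ≠ u j ∧ v i ≠ v j := by
    intro i j hij
    have := hL i j hij
    rw [hN i, hN j] at this
    refine ne_of_skew_normalLine (p := p i) (q := q i) (p' := p j) (q' := q j)
      ⟨isLine_normalLine _ _ _ _, isLine_normalLine _ _ _ _, ?_⟩
    have := this.2.2
    rw [← Submodule.map_inf _ (hinj 0)] at this
    exact Submodule.map_injective_of_injective (hinj 0) (by rw [this, Submodule.map_bot])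
  obtain ⟨π, hπ⟩ := exists_perm_strictMono_comp (u := u) fun i j hij => by
    by_contra hne'
    exact (hne i j hne').1 hij
  obtain ⟨τ, hτ⟩ := exists_perm_strictMono_comp (u := v ∘ π) fun i j hij => by
    by_contra hne'
    exact (hne _ _ (π.injective.ne hne')).2 hij
  refine ⟨τ⁻¹, π, 1, fun t i => (normalLine ((1 - t) * u (π i) + t * (i.val + 1))
    ((1 - t) * v (π i) + t * ((τ⁻¹ i).val + 1)) ((1 - t) * p (π i))
    ((1 - t) * q (π i))).map (h t).mulVecLin, ?_, ?_, ?_, ?_⟩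
  · intro i
    refine ⟨fun t => (h t).mulVec ![1, (1 - t) * u (π i) + t * (i.val + 1), 0, 0],
      fun t => (h t).mulVec ![(1 - t) * p (π i), (1 - t) * q (π i),
        (1 - t) * v (π i) + t * ((τ⁻¹ i).val + 1), 1], ?_, ?_, ?_⟩
    · refine (hc.matrix_mulVec (continuous_pi fun k => ?_)).continuousOn
      fin_cases k <;> simp <;> fun_prop
    · refine (hc.matrix_mulVec (continuous_pi fun k => ?_)).continuousOn
      fin_cases k <;> simp <;> fun_prop
    · intro t _
      simp [normalLine, Submodule.map_span, Set.image_pair]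
  · intro t ht i j hij
    refine Skew.map (skew_normalLine ?_ ?_) (hinj t)
    · exact interpolate_ne (u := u ∘ π) (τ := id) Function.injective_id (fun i j h => hπ h) ht hij
    · refine interpolate_ne (u := v ∘ π) (Equiv.injective _) (fun i j h => ?_) ht hij
      simpa using hτ h
  · funext i
    simp [hN]
  · funext i
    simp [h1, normalLine, joinConfig]
end

section
/- (Linking indices in a join configuration) Let σ be a permutation of {1,…,n} and let J(σ)={L₁,…,Lₙ} be the join configuration, where Lᵢ is the 2-dimensional subspace of ℝ⁴ spanned by (1,i,0,0) and (0,0,σ(i),1). Then for all 1≤i<j<k≤n, the triple linking index satisfies lk(Lᵢ,Lⱼ,Lₖ) = (−1)^r, where r is the number of inversions of order in the sequence (σ(i),σ(j),σ(k)). -/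
open Submodule

theorem det2_pair_comm (a b c d : V4) : det2 a b c d = det2 c d a b := by
  simp only [det2_eq]
  ring

theorem exists_det2_eq_mul_of_span_le {a b c d : V4}
    (h : span ℝ {c, d} ≤ span ℝ {a, b}) :
    ∃ m : ℝ, ∀ e f, det2 c d e f = m * det2 a b e f := by
  obtain ⟨α, β, rfl⟩ := mem_span_pair.1 (h (subset_span (by simp : c ∈ ({c, d} : Set V4))))
  obtain ⟨γ, δ, rfl⟩ := mem_span_pair.1 (h (subset_span (by simp : d ∈ ({_, d} : Set V4))))
  refine ⟨α * δ - β * γ, fun e f => ?_⟩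
  simp only [det2_eq, Pi.add_apply, Pi.smul_apply, smul_eq_mul]
  ring

theorem exists_det2_eq_mul_of_span_eq {a b c d e f : V4}
    (h : span ℝ {a, b} = span ℝ {c, d}) (h0 : det2 a b e f ≠ 0) :
    ∃ m : ℝ, m ≠ 0 ∧ ∀ x y, det2 c d x y = m * det2 a b x y := by
  obtain ⟨m, hm⟩ := exists_det2_eq_mul_of_span_le h.ge
  obtain ⟨m', hm'⟩ := exists_det2_eq_mul_of_span_le h.le
  refine ⟨m, ?_, hm⟩
  rintro rfl
  exact h0 (by rw [hm', hm]; simp)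

theorem real_sign_mul (x y : ℝ) : Real.sign (x * y) = Real.sign x * Real.sign y := by
  rcases lt_trichotomy x 0 with hx | rfl | hx <;> rcases lt_trichotomy y 0 with hy | rfl | hy <;>
    simp [Real.sign_of_neg, Real.sign_of_pos, mul_pos_of_neg_of_neg, mul_neg_of_neg_of_pos,
      mul_neg_of_pos_of_neg, *]

/-- The triple linking index may be computed from any choice of bases. -/
theorem lk_span {a b c d e f : V4} (h₁ : det2 a b c d ≠ 0) (h₂ : det2 c d e f ≠ 0) :
    lk (span ℝ {a, b}) (span ℝ {c, d}) (span ℝ {e, f}) =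
      Real.sign (det2 a b c d * det2 a b e f * det2 c d e f) := by
  have h : ∃ v : Fin 6 → V4, span ℝ {a, b} = span ℝ {v 0, v 1} ∧
      span ℝ {c, d} = span ℝ {v 2, v 3} ∧ span ℝ {e, f} = span ℝ {v 4, v 5} :=
    ⟨![a, b, c, d, e, f], rfl, rfl, rfl⟩
  rw [lk, dif_pos h]
  obtain ⟨hP, hQ, hR⟩ := h.choose_spec
  generalize h.choose = v at hP hQ hR ⊢
  obtain ⟨p, hp, hp'⟩ := exists_det2_eq_mul_of_span_eq hP h₁
  obtain ⟨q, hq, hq'⟩ := exists_det2_eq_mul_of_span_eq hQ h₂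
  obtain ⟨r, hr, hr'⟩ := exists_det2_eq_mul_of_span_eq hR (det2_pair_comm c d e f ▸ h₂)
  have hpq : det2 (v 0) (v 1) (v 2) (v 3) = p * q * det2 a b c d := by
    rw [hp', det2_pair_comm, hq', det2_pair_comm c, mul_assoc]
  have hpr : det2 (v 0) (v 1) (v 4) (v 5) = p * r * det2 a b e f := by
    rw [hp', det2_pair_comm, hr', det2_pair_comm e, mul_assoc]
  have hqr : det2 (v 2) (v 3) (v 4) (v 5) = q * r * det2 c d e f := by
    rw [hq', det2_pair_comm, hr', det2_pair_comm e, mul_assoc]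
  have hsq : 0 < (p * q * r) ^ 2 := by positivity
  rw [hpq, hpr, hqr, ← one_mul (Real.sign (det2 a b c d * _ * _)), ← Real.sign_of_pos hsq,
    ← real_sign_mul]
  congr 1
  ring

theorem det2_join (x y s t : ℝ) :
    det2 ![1, x, 0, 0] ![0, 0, s, 1] ![1, y, 0, 0] ![0, 0, t, 1] = (y - x) * (t - s) := by
  simp [det2_eq]
  ring

theorem sign_val_sub {n : ℕ} {a b : Fin n} (h : a ≠ b) :
    Real.sign (((b.val : ℝ) + 1) - ((a.val : ℝ) + 1)) = (-1) ^ (if b < a then 1 else 0) := by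
  rcases h.lt_or_gt with h | h
  · have : (a.val : ℝ) < b.val := by exact_mod_cast h
    rw [Real.sign_of_pos (by linarith), if_neg h.not_gt, pow_zero]
  · have : (b.val : ℝ) < a.val := by exact_mod_cast h
    rw [Real.sign_of_neg (by linarith), if_pos h, pow_one]

theorem lk_joinConfig {n : ℕ} (σ : Equiv.Perm (Fin n)) (i j k : Fin n)
    (hij : i < j) (hjk : j < k) :
    lk (joinConfig σ i) (joinConfig σ j) (joinConfig σ k) =
      (-1 : ℝ) ^ (((if σ j < σ i then 1 else 0) +
        (if σ k < σ i then 1 else 0) + (if σ k < σ j then 1 else 0) : ℕ)) := by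
  have hσ {a b : Fin n} (h : a < b) : σ a ≠ σ b := σ.injective.ne h.ne
  have hsub {a b : Fin n} (h : a ≠ b) : ((b.val : ℝ) + 1) - ((a.val : ℝ) + 1) ≠ 0 := by
    rw [add_sub_add_right_eq_sub, sub_ne_zero]
    exact_mod_cast Fin.val_ne_of_ne h.symm
  have hpos {a b : Fin n} (h : a < b) : 0 < ((b.val : ℝ) + 1) - ((a.val : ℝ) + 1) := by
    rw [add_sub_add_right_eq_sub, sub_pos]
    exact_mod_cast h
  have hik := hij.trans hjk
  have hne {a b : Fin n} (h : a < b) := mul_ne_zero (hsub h.ne) (hsub (hσ h))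
  simp only [joinConfig]
  rw [lk_span (by rw [det2_join]; exact hne hij) (by rw [det2_join]; exact hne hjk)]
  simp only [det2_join, real_sign_mul, Real.sign_of_pos (hpos hij), Real.sign_of_pos (hpos hjk),
    Real.sign_of_pos (hpos hik), one_mul, sign_val_sub (hσ hij), sign_val_sub (hσ hjk),
    sign_val_sub (hσ hik), pow_add]
end
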